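/- arXiv:0809.4389 — 6 statements merged into one kernel-verified Lean document; each statement's English description precedes it below -/
import Mathlib

section
/- Let 0 < α < 1 and v ≥ 0. For every w > 0 with w^α + v > 0, the Laplace transform of the stretched Mittag-Leffler function satisfies ∫₀^∞ e^{−wt} E_α(−v t^α) dt = w^{α−1} / (w^α + v), where the integral converges. -/
open MeasureTheory Set

/-- The one-parameter Mittag-Leffler function `E_α(z) = ∑ zⁿ / Γ(αn+1)`. -/
noncomputable def mittagLeffler (α z : ℝ) : ℝ :=
  ∑' n : ℕ, z ^ n / Real.Gamma (α * n + 1)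


lemma ml_gamma_lower (s R : ℝ) (hs : 0 ≤ s) (hR : 0 < R) :
    Real.exp (-R) * R ^ s ≤ Real.Gamma (s + 1) := by
  rw [Real.Gamma_eq_integral (by linarith)]
  have hIntg := Real.GammaIntegral_convergent (s := s + 1) (by linarith)
  have h1 : ∫ x in Ioi R, Real.exp (-x) * R ^ s = Real.exp (-R) * R ^ s := by
    rw [integral_mul_const, integral_exp_neg_Ioi]
  rw [← h1]
  have hsub : Ioi R ⊆ Ioi (0 : ℝ) := Ioi_subset_Ioi hR.le
  calc ∫ x in Ioi R, Real.exp (-x) * R ^ s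
      ≤ ∫ x in Ioi R, Real.exp (-x) * x ^ (s + 1 - 1) := by
        apply setIntegral_mono_on
        · exact (integrableOn_exp_neg_Ioi R).mul_const _
        · exact hIntg.mono_set hsub
        · exact measurableSet_Ioi
        · intro x hx
          have : R < x := hx
          rw [add_sub_cancel_right]
          gcongr
    _ ≤ ∫ x in Ioi 0, Real.exp (-x) * x ^ (s + 1 - 1) := by
        apply setIntegral_mono_set hIntg
        · filter_upwards [ae_restrict_mem measurableSet_Ioi] with x hx
          have : 0 < x := hx
          simp only [Pi.zero_apply]
          positivity
        · exact hsub.eventuallyLE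

lemma ml_gamma_pos (α : ℝ) (hα : 0 < α) (n : ℕ) : 0 < Real.Gamma (α * n + 1) :=
  Real.Gamma_pos_of_pos (by positivity)

lemma ml_summable (α z : ℝ) (hα : 0 < α) :
    Summable fun n : ℕ => z ^ n / Real.Gamma (α * n + 1) := by
  set B : ℝ := 2 * |z| + 1 with hB
  have hBpos : 0 < B := by positivity
  set R : ℝ := B ^ (1 / α) with hR
  have hRpos : 0 < R := by positivity
  have hRα : R ^ α = B := by
    rw [hR, ← Real.rpow_mul hBpos.le]
    field_simp
    simp
  have hr : |z| / B < 1 := by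
    rw [div_lt_one hBpos]
    have := abs_nonneg z
    linarith
  have hg : Summable fun n : ℕ => Real.exp R * (|z| / B) ^ n :=
    (summable_geometric_of_lt_one (by positivity) hr).mul_left _
  refine Summable.of_norm_bounded hg ?_
  intro n
  have hlow := ml_gamma_lower (α * n) R (by positivity) hRpos
  rw [Real.rpow_mul hRpos.le, hRα, Real.rpow_natCast] at hlow
  have hG := ml_gamma_pos α hα n
  rw [norm_div, norm_pow, Real.norm_eq_abs, Real.norm_of_nonneg hG.le, div_pow,
    div_le_iff₀ hG]
  calc |z| ^ n = Real.exp R * (|z| ^ n / B ^ n) * (Real.exp (-R) * B ^ n) := by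
        rw [Real.exp_neg]
        field_simp
    _ ≤ _ := by gcongr

lemma ml_lipschitz (α M : ℝ) (hα : 0 < α) (hM : 1 ≤ M) :
    ∃ L : ℝ, 0 ≤ L ∧ ∀ x y : ℝ, |x| ≤ M → |y| ≤ M →
      |mittagLeffler α x - mittagLeffler α y| ≤ L * |x - y| := by
  have hS := ml_summable α (2 * M) hα
  refine ⟨∑' n : ℕ, (2 * M) ^ n / Real.Gamma (α * n + 1), ?_, ?_⟩
  · exact tsum_nonneg fun n => div_nonneg (by positivity) (ml_gamma_pos α hα n).le
  intro x y hx hy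
  have hx1 := ml_summable α x hα
  have hy1 := ml_summable α y hα
  unfold mittagLeffler
  rw [← hx1.tsum_sub hy1, ← tsum_mul_right]
  rw [← Real.norm_eq_abs]
  refine tsum_of_norm_bounded (hS.mul_right _).hasSum ?_
  intro n
  have hG := ml_gamma_pos α hα n
  rw [← sub_div, norm_div, Real.norm_of_nonneg hG.le, div_mul_eq_mul_div]
  gcongr
  rw [Real.norm_eq_abs]
  refine (abs_pow_sub_pow_le x y n).trans ?_
  have h1 : max |x| |y| ≤ M := max_le hx hy
  have h0 : 0 ≤ max |x| |y| := le_max_of_le_left (abs_nonneg x)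
  have h2 : (max |x| |y|) ^ (n - 1) ≤ M ^ n :=
    (pow_le_pow_left₀ h0 h1 _).trans (pow_le_pow_right₀ hM (by omega))
  have h3 : (n : ℝ) ≤ 2 ^ n := by exact_mod_cast Nat.lt_two_pow_self.le
  calc |x - y| * n * (max |x| |y|) ^ (n - 1) ≤ |x - y| * 2 ^ n * M ^ n := by gcongr
    _ = (2 * M) ^ n * |x - y| := by rw [mul_pow]; ring

lemma ml_continuous (α : ℝ) (hα : 0 < α) : Continuous (mittagLeffler α) := by
  rw [continuous_iff_continuousAt]
  intro x
  obtain ⟨L, hL, h⟩ := ml_lipschitz α (|x| + 1) hα (by linarith [abs_nonneg x])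
  rw [ContinuousAt, tendsto_iff_norm_sub_tendsto_zero]
  have hlim : Filter.Tendsto (fun y => L * |y - x|) (nhds x) (nhds 0) := by
    have : Continuous fun y => L * |y - x| := by fun_prop
    simpa using this.tendsto x
  refine squeeze_zero' (Filter.Eventually.of_forall fun y => norm_nonneg _) ?_ hlim
  filter_upwards [Metric.ball_mem_nhds x one_pos] with y hy
  rw [Metric.mem_ball, Real.dist_eq] at hy
  refine h y x ?_ (by linarith)
  have := abs_sub_abs_le_abs_sub y x
  linarith

lemma ml_beta (a b t : ℝ) (ha : 0 < a) (hb : 0 < b) (ht : 0 < t) :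
    ∫ s in (0:ℝ)..t, s ^ (a - 1) * (t - s) ^ (b - 1) =
      t ^ (a + b - 1) * (Real.Gamma a * Real.Gamma b / Real.Gamma (a + b)) := by
  have h := Complex.betaIntegral_scaled a b ht
  have h2 := Complex.Gamma_mul_Gamma_eq_betaIntegral (s := a) (t := b) (by simpa) (by simpa)
  have h3 : Complex.betaIntegral a b =
      ((Real.Gamma a * Real.Gamma b / Real.Gamma (a + b) : ℝ) : ℂ) := by
    have hne : Real.Gamma (a + b) ≠ 0 := (Real.Gamma_pos_of_pos (by linarith)).ne'
    rw [← Complex.ofReal_add, Complex.Gamma_ofReal, Complex.Gamma_ofReal,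
      Complex.Gamma_ofReal] at h2
    have hne' : (Real.Gamma (a + b) : ℂ) ≠ 0 := by exact_mod_cast hne
    push_cast
    rw [h2]
    field_simp
  rw [h3] at h
  apply Complex.ofReal_injective
  rw [Complex.ofReal_mul, Complex.ofReal_cpow ht.le]
  push_cast at h ⊢
  rw [← h, ← intervalIntegral.integral_ofReal]
  apply intervalIntegral.integral_congr
  intro s hs
  rw [uIcc_of_le ht.le] at hs
  simp only
  rw [Complex.ofReal_mul, Complex.ofReal_cpow hs.1, Complex.ofReal_cpow (sub_nonneg.2 hs.2)]
  push_cast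
  rfl

lemma ml_ker_int (α t : ℝ) (hα1 : α < 1) :
    IntervalIntegrable (fun s : ℝ => (t - s) ^ (-α)) volume 0 t := by
  have h : IntervalIntegrable (fun s : ℝ => s ^ (-α)) volume 0 t :=
    intervalIntegral.intervalIntegrable_rpow' (by linarith)
  have := (h.comp_sub_left t).symm
  simpa using this

lemma ml_f_cont (α v : ℝ) (hα0 : 0 < α) :
    Continuous fun t : ℝ => mittagLeffler α (-v * t ^ α) :=
  (ml_continuous α hα0).comp (continuous_const.mul (Real.continuous_rpow_const hα0.le))

lemma ml_term (α v s : ℝ) (hs : 0 ≤ s) (n : ℕ) :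
    (-v * s ^ α) ^ n / Real.Gamma (α * n + 1)
      = (-v) ^ n / Real.Gamma (α * n + 1) * s ^ (α * n) := by
  rw [mul_pow, Real.rpow_mul hs, Real.rpow_natCast]
  ring

lemma ml_hasSum_int (α v t : ℝ) (hα0 : 0 < α) (hv : 0 ≤ v) (ht : 0 < t) (φ : ℝ → ℝ)
    (hφ0 : ∀ s ∈ Ioc 0 t, 0 ≤ φ s) (hφ : IntervalIntegrable φ volume 0 t) :
    HasSum (fun n : ℕ => (-v) ^ n / Real.Gamma (α * n + 1) * ∫ s in (0:ℝ)..t, s ^ (α * n) * φ s)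
      (∫ s in (0:ℝ)..t, mittagLeffler α (-v * s ^ α) * φ s) := by
  have hS := ml_summable α (v * t ^ α) hα0
  simp_rw [← intervalIntegral.integral_const_mul]
  refine intervalIntegral.hasSum_integral_of_dominated_convergence
    (fun n s => (v * t ^ α) ^ n / Real.Gamma (α * n + 1) * φ s) ?_ ?_ ?_ ?_ ?_
  · intro n
    refine AEStronglyMeasurable.const_mul (AEStronglyMeasurable.mul ?_ ?_) _
    · exact (Real.continuous_rpow_const (by positivity)).aestronglyMeasurable
    · exact hφ.def'.aestronglyMeasurable
  · intro n
    refine Filter.Eventually.of_forall fun s hs => ?_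
    rw [uIoc_of_le ht.le] at hs
    have hG := ml_gamma_pos α hα0 n
    have h0 := hφ0 s hs
    have hs0 : 0 ≤ s := hs.1.le
    rw [← mul_assoc, ← ml_term α v s hs0, norm_mul, norm_div, norm_pow, norm_mul, norm_neg,
      Real.norm_of_nonneg h0, Real.norm_of_nonneg hG.le, Real.norm_of_nonneg hv,
      Real.norm_of_nonneg (Real.rpow_nonneg hs0 α)]
    have := hs.2
    gcongr
  · exact Filter.Eventually.of_forall fun s hs => hS.mul_right _
  · simp_rw [tsum_mul_right]
    exact hφ.const_mul _
  · refine Filter.Eventually.of_forall fun s hs => ?_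
    rw [uIoc_of_le ht.le] at hs
    simp_rw [← mul_assoc, ← ml_term α v s hs.1.le]
    exact (ml_summable α _ hα0).hasSum.mul_right _

lemma ml_identity (α v t : ℝ) (hα0 : 0 < α) (hα1 : α < 1) (hv : 0 ≤ v) (ht : 0 < t) :
    ∫ s in (0:ℝ)..t, mittagLeffler α (-v * s ^ α) * ((t - s) ^ (-α) + v * Real.Gamma (1 - α))
      = t ^ (1 - α) / (1 - α) := by
  have hker := ml_ker_int α t hα1
  have hA := ml_hasSum_int α v t hα0 hv ht (fun s => (t - s) ^ (-α))
    (fun s hs => Real.rpow_nonneg (sub_nonneg.2 hs.2) _) hker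
  have hB := ml_hasSum_int α v t hα0 hv ht (fun s => 1) (fun s hs => zero_le_one)
    intervalIntegrable_const
  have hf := ml_f_cont α v hα0
  have hAint : IntervalIntegrable (fun s => mittagLeffler α (-v * s ^ α) * (t - s) ^ (-α))
      volume 0 t := hker.continuousOn_mul hf.continuousOn
  have hBint : IntervalIntegrable (fun s => mittagLeffler α (-v * s ^ α) *
      (v * Real.Gamma (1 - α))) volume 0 t := (hf.mul continuous_const).intervalIntegrable _ _
  simp_rw [mul_add]
  rw [intervalIntegral.integral_add hAint hBint, intervalIntegral.integral_mul_const]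
  simp only [mul_one] at hB
  have hG1 : 0 < Real.Gamma (1 - α) := Real.Gamma_pos_of_pos (by linarith)
  have hAval : ∀ n : ℕ, ∫ s in (0:ℝ)..t, s ^ (α * n) * (t - s) ^ (-α) =
      t ^ (α * n + 1 - α) * (Real.Gamma (α * n + 1) * Real.Gamma (1 - α) /
        Real.Gamma (α * n + 2 - α)) := by
    intro n
    have := ml_beta (α * n + 1) (1 - α) t (by positivity) (by linarith) ht
    have e1 : α * n + 1 - 1 = α * n := by ring
    have e2 : 1 - α - 1 = -α := by ring
    have e3 : α * n + 1 + (1 - α) - 1 = α * n + 1 - α := by ring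
    have e4 : α * n + 1 + (1 - α) = α * n + 2 - α := by ring
    rwa [e3, e4, e1, e2] at this
  have hBval : ∀ n : ℕ, ∫ s in (0:ℝ)..t, s ^ (α * n) = t ^ (α * n + 1) / (α * n + 1) := by
    intro n
    have hp : 0 ≤ α * n := by positivity
    rw [integral_rpow (Or.inl (by linarith)), Real.zero_rpow (by linarith), sub_zero]
  simp_rw [hAval] at hA
  simp_rw [hBval] at hB
  have hC := hB.mul_left (-(v * Real.Gamma (1 - α)))
  have hkey := (hasSum_nat_add_iff (f := fun n : ℕ => (-v) ^ n / Real.Gamma (α * n + 1) *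
      (t ^ (α * n + 1 - α) * (Real.Gamma (α * n + 1) * Real.Gamma (1 - α) /
        Real.Gamma (α * n + 2 - α)))) 1 (g := -(v * Real.Gamma (1 - α)) *
          ∫ s in (0:ℝ)..t, mittagLeffler α (-v * s ^ α))).1 (by
      refine Eq.mp (congrArg (fun g : ℕ → ℝ => HasSum g _) (funext fun n => ?_)) hC
      symm
      have e1 : α * ((n + 1 : ℕ) : ℝ) + 1 - α = α * n + 1 := by push_cast; ring
      have e2 : α * ((n + 1 : ℕ) : ℝ) + 2 - α = (α * n + 1) + 1 := by push_cast; ring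
      have hpos : 0 < α * n + 1 := by positivity
      have hGn := ml_gamma_pos α hα0 n
      have hGn1 := ml_gamma_pos α hα0 (n + 1)
      rw [e1, e2, Real.Gamma_add_one hpos.ne', pow_succ]
      field_simp)
  have huniq := hA.unique hkey
  rw [huniq]
  have h2 : Real.Gamma (2 - α) = (1 - α) * Real.Gamma (1 - α) := by
    rw [← Real.Gamma_add_one (by linarith)]
    congr 1
    ring
  have h1α : 1 - α ≠ 0 := by linarith
  simp [h2]
  field_simp
  ring

lemma ml_one_identity (α c t : ℝ) (hα1 : α < 1) :
    ∫ s in (0:ℝ)..t, ((t - s) ^ (-α) + c) = t ^ (1 - α) / (1 - α) + c * t := by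
  rw [intervalIntegral.integral_add (ml_ker_int α t hα1) intervalIntegrable_const,
    intervalIntegral.integral_comp_sub_left (fun s => s ^ (-α)) t,
    integral_rpow (Or.inl (by linarith))]
  have e : -α + 1 = 1 - α := by ring
  have h1α : 1 - α ≠ 0 := by linarith
  simp [e, Real.zero_rpow h1α]
  ring

lemma ml_rpow_diff_upper (α s t : ℝ) (hα1 : α < 1) (ht : 0 < t) (hs : 0 ≤ s) (hst : s ≤ t) :
    t ^ α - s ^ α ≤ t ^ (α - 1) * (t - s) := by
  rcases hs.eq_or_lt with rfl | hs
  · have : t ^ (α - 1) * (t - 0) = t ^ α := by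
      rw [sub_zero, Real.rpow_sub_one ht.ne']
      field_simp
    rw [this]
    have := Real.rpow_nonneg (le_refl (0:ℝ)) α
    linarith
  have h1 : t ^ (α - 1) ≤ s ^ (α - 1) :=
    Real.rpow_le_rpow_of_nonpos hs hst (by linarith)
  have h2 : t ^ α = t ^ (α - 1) * t := by
    rw [Real.rpow_sub_one ht.ne']; field_simp
  have h3 : s ^ α = s ^ (α - 1) * s := by
    rw [Real.rpow_sub_one hs.ne']; field_simp
  rw [h2, h3]
  nlinarith

lemma ml_rpow_diff_lower (α h t : ℝ) (hα0 : 0 < α) (hα1 : α < 1) (ht : 0 < t)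
    (hh0 : 0 < h) (hht : h < t) :
    h * t ^ (-α) ≤ t ^ (1 - α) / (1 - α) - (t - h) ^ (1 - α) / (1 - α) := by
  have h1 : -1 ≤ -(h / t) := by
    have : h / t ≤ 1 := (div_le_one ht).2 hht.le
    linarith
  have hb := rpow_one_add_le_one_add_mul_self h1 (p := 1 - α) (by linarith) (by linarith)
  have e : t - h = t * (1 + -(h / t)) := by field_simp; ring
  have hp : 0 < t ^ (-α) := Real.rpow_pos_of_pos ht _
  have e2 : t ^ (1 - α) = t * t ^ (-α) := by
    rw [sub_eq_add_neg, Real.rpow_add ht, Real.rpow_one]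
  have h1α : 0 < 1 - α := by linarith
  rw [← sub_div, le_div_iff₀ h1α, e, Real.mul_rpow ht.le (by linarith), e2]
  have := mul_le_mul_of_nonneg_left hb (mul_pos ht hp).le
  have e3 : t * t ^ (-α) * (1 + (1 - α) * -(h / t)) =
      t * t ^ (-α) - h * t ^ (-α) * (1 - α) := by field_simp; ring
  linarith

lemma ml_zero (α : ℝ) : mittagLeffler α 0 = 1 := by
  unfold mittagLeffler
  rw [tsum_eq_single 0]
  · simp
  · intro n hn
    simp [hn]

lemma ml_nonneg (α v T : ℝ) (hα0 : 0 < α) (hα1 : α < 1) (hv : 0 ≤ v) (hT : 0 ≤ T) :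
    0 ≤ mittagLeffler α (-v * T ^ α) := by
  by_contra hneg
  push Not at hneg
  have hf := ml_f_cont α v hα0
  obtain ⟨t₀, ht₀, hmin⟩ := isCompact_Icc.exists_isMinOn (nonempty_Icc.2 hT) hf.continuousOn
  have hG1 : 0 < Real.Gamma (1 - α) := Real.Gamma_pos_of_pos (by linarith)
  have hid := fun t ht => ml_identity α v t hα0 hα1 hv ht
  set c := v * Real.Gamma (1 - α) with hc
  have hc0 : 0 ≤ c := by positivity
  obtain ⟨L, hL0, hL⟩ := ml_lipschitz α (v * t₀ ^ α + 1) hα0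
    (by have := mul_nonneg hv (Real.rpow_nonneg ht₀.1 α); linarith)
  have hf0 : mittagLeffler α (-v * (0:ℝ) ^ α) = 1 := by
    rw [Real.zero_rpow hα0.ne', mul_zero, ml_zero]
  have hlip : ∀ s ∈ Icc 0 t₀, mittagLeffler α (-v * s ^ α) - mittagLeffler α (-v * t₀ ^ α)
      ≤ L * (v * (t₀ ^ α - s ^ α)) := by
    intro s hs
    have hsα := Real.rpow_nonneg hs.1 α
    have hle : s ^ α ≤ t₀ ^ α := Real.rpow_le_rpow hs.1 hs.2 hα0.le
    have hvle : v * s ^ α ≤ v * t₀ ^ α := mul_le_mul_of_nonneg_left hle hv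
    have h0 : 0 ≤ v * s ^ α := mul_nonneg hv hsα
    have := hL (-v * s ^ α) (-v * t₀ ^ α)
      (by rw [neg_mul, abs_neg, abs_of_nonneg h0]; linarith)
      (by rw [neg_mul, abs_neg, abs_of_nonneg (h0.trans hvle)]; linarith)
    have e : -v * s ^ α - -v * t₀ ^ α = v * (t₀ ^ α - s ^ α) := by ring
    rw [e, abs_of_nonneg (mul_nonneg hv (by linarith))] at this
    exact (le_abs_self _).trans this
  set f : ℝ → ℝ := fun t => mittagLeffler α (-v * t ^ α) with hfdef
  have hid' : ∀ t, 0 < t → ∫ s in (0:ℝ)..t, f s * ((t - s) ^ (-α) + c) = t ^ (1 - α) / (1 - α) :=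
    hid
  change ∀ s ∈ Icc 0 t₀, f s - f t₀ ≤ L * (v * (t₀ ^ α - s ^ α)) at hlip
  have hmin' : ∀ s ∈ Icc 0 t₀, 0 ≤ f s - f t₀ := fun s hs =>
    sub_nonneg.2 (hmin ⟨hs.1, hs.2.trans ht₀.2⟩)
  have hfT : f t₀ ≤ f T := hmin ⟨hT, le_refl T⟩
  have hneg' : f T < 0 := hneg
  have hf0' : f 0 = 1 := hf0
  clear_value f
  set m := f t₀ with hm
  have hm0 : m < 0 := lt_of_le_of_lt hfT hneg'
  have ht₀pos : 0 < t₀ := by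
    rcases ht₀.1.eq_or_lt with h | h
    · rw [← h] at hm
      linarith
    · exact h
  set C := L * (v * t₀ ^ (α - 1)) with hC
  have hC0 : 0 ≤ C := by positivity
  have hlip' : ∀ s ∈ Icc 0 t₀, f s - m ≤ C * (t₀ - s) := by
    intro s hs
    refine (hlip s hs).trans ?_
    have := ml_rpow_diff_upper α s t₀ hα1 ht₀pos hs.1 hs.2
    calc L * (v * (t₀ ^ α - s ^ α)) ≤ L * (v * (t₀ ^ (α - 1) * (t₀ - s))) := by gcongr
      _ = C * (t₀ - s) := by rw [hC]; ring
  have hkint : ∀ t, IntervalIntegrable (fun s => (t - s) ^ (-α) + c) volume 0 t := fun t =>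
    (ml_ker_int α t hα1).add intervalIntegrable_const
  have hgc : Continuous fun s => f s - m := hf.sub continuous_const
  have hgk : ∀ t, IntervalIntegrable (fun s => (f s - m) * ((t - s) ^ (-α) + c)) volume 0 t :=
    fun t => (hkint t).continuousOn_mul hgc.continuousOn
  have hD : ∀ t, 0 < t → ∫ s in (0:ℝ)..t, (f s - m) * ((t - s) ^ (-α) + c) =
      t ^ (1 - α) / (1 - α) - m * (t ^ (1 - α) / (1 - α) + c * t) := by
    intro t ht
    simp_rw [sub_mul]
    rw [intervalIntegral.integral_sub ((hkint t).continuousOn_mul hf.continuousOn)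
      ((hkint t).const_mul m), hid' t ht, intervalIntegral.integral_const_mul,
      ml_one_identity α c t hα1]
  have hmain : ∀ h, 0 < h → h < t₀ →
      (1 - m) * t₀ ^ (-α) ≤ C * (h ^ (1 - α) / (1 - α) + c * h) := by
    intro h hh0 hht
    set t := t₀ - h with ht
    have htpos : 0 < t := by linarith
    have htt : t ≤ t₀ := by linarith
    have hi1 : IntervalIntegrable (fun s => (f s - m) * ((t₀ - s) ^ (-α) + c)) volume 0 t :=
      (hgk t₀).mono_set (by
        rw [uIcc_of_le htpos.le, uIcc_of_le ht₀pos.le]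
        exact Icc_subset_Icc_right htt)
    have hsub2 : uIcc t t₀ ⊆ uIcc 0 t₀ := by
      rw [uIcc_of_le htt, uIcc_of_le ht₀pos.le]
      exact Icc_subset_Icc_left htpos.le
    have hi2 := (hgk t₀).mono_set hsub2
    have hk2 := (hkint t₀).mono_set hsub2
    have hsplit := intervalIntegral.integral_add_adjacent_intervals hi1 hi2
    have hle1 : ∫ s in (0:ℝ)..t, (f s - m) * ((t₀ - s) ^ (-α) + c) ≤
        ∫ s in (0:ℝ)..t, (f s - m) * ((t - s) ^ (-α) + c) := by
      refine intervalIntegral.integral_mono_on_of_le_Ioo htpos.le hi1 (hgk t) ?_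
      intro s hs
      have hg := hmin' s ⟨hs.1.le, hs.2.le.trans htt⟩
      have : (t₀ - s) ^ (-α) ≤ (t - s) ^ (-α) :=
        Real.rpow_le_rpow_of_nonpos (sub_pos.2 hs.2) (by linarith) (by linarith)
      gcongr
    have hle2 : ∫ s in t..t₀, (f s - m) * ((t₀ - s) ^ (-α) + c) ≤
        ∫ s in t..t₀, (C * h) * ((t₀ - s) ^ (-α) + c) := by
      refine intervalIntegral.integral_mono_on htt hi2 (hk2.const_mul _) ?_
      intro s hs
      have hg := hlip' s ⟨htpos.le.trans hs.1, hs.2⟩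
      have hk0 : 0 ≤ (t₀ - s) ^ (-α) := Real.rpow_nonneg (sub_nonneg.2 hs.2) _
      have : C * (t₀ - s) ≤ C * h := by
        have := hs.1
        gcongr
        linarith
      exact mul_le_mul_of_nonneg_right (hg.trans this) (by linarith)
    have hval : ∫ s in t..t₀, ((t₀ - s) ^ (-α) + c) = h ^ (1 - α) / (1 - α) + c * h := by
      rw [← ml_one_identity α c h hα1,
        intervalIntegral.integral_comp_sub_left (fun s => s ^ (-α) + c) t₀,
        intervalIntegral.integral_comp_sub_left (fun s => s ^ (-α) + c) h, ht]
      simp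
    rw [intervalIntegral.integral_const_mul, hval] at hle2
    rw [hD t htpos] at hle1
    rw [hD t₀ ht₀pos] at hsplit
    have hlow := ml_rpow_diff_lower α h t₀ hα0 hα1 ht₀pos hh0 hht
    rw [← ht] at hlow
    have hfin : (1 - m) * (h * t₀ ^ (-α)) ≤ C * h * (h ^ (1 - α) / (1 - α) + c * h) := by
      have h1 := mul_le_mul_of_nonneg_left hlow (by linarith : 0 ≤ 1 - m)
      have h2 : 0 ≤ -m * (c * h) := mul_nonneg (by linarith) (by positivity)
      have h3 : c * t = c * t₀ - c * h := by rw [ht]; ring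
      rw [h3] at hle1
      nlinarith
    refine le_of_mul_le_mul_left ?_ hh0
    linarith
  have hlim : Filter.Tendsto (fun h : ℝ => C * (h ^ (1 - α) / (1 - α) + c * h))
      (nhdsWithin 0 (Ioi 0)) (nhds 0) := by
    have hcont : Continuous fun h : ℝ => C * (h ^ (1 - α) / (1 - α) + c * h) := by
      have := Real.continuous_rpow_const (q := 1 - α) (by linarith)
      fun_prop
    have := hcont.tendsto 0
    have h1α : 1 - α ≠ 0 := by linarith
    simp only [Real.zero_rpow h1α, zero_div, mul_zero, add_zero] at this
    exact this.mono_left nhdsWithin_le_nhds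
  have hle : (1 - m) * t₀ ^ (-α) ≤ 0 := by
    refine ge_of_tendsto hlim ?_
    filter_upwards [Ioo_mem_nhdsGT ht₀pos] with h hh
    exact hmain h hh.1 hh.2
  have hpos : 0 < (1 - m) * t₀ ^ (-α) := mul_pos (by linarith) (Real.rpow_pos_of_pos ht₀pos _)
  linarith

lemma ml_lint_rpow (a w : ℝ) (ha : 0 < a) (hw : 0 < w) :
    ∫⁻ t in Ioi (0:ℝ), ENNReal.ofReal (Real.exp (-w * t) * t ^ (a - 1)) =
      ENNReal.ofReal (w ^ (-a) * Real.Gamma a) := by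
  have h := Real.integral_rpow_mul_exp_neg_mul_Ioi ha hw
  have e : ∫ t in Ioi (0:ℝ), Real.exp (-w * t) * t ^ (a - 1) = w ^ (-a) * Real.Gamma a := by
    rw [Real.rpow_neg hw.le, ← Real.inv_rpow hw.le, ← one_div, ← h]
    refine integral_congr_ae (Filter.Eventually.of_forall fun t => ?_)
    simp only [neg_mul]
    ring
  have hpos : 0 < w ^ (-a) * Real.Gamma a :=
    mul_pos (Real.rpow_pos_of_pos hw _) (Real.Gamma_pos_of_pos ha)
  have hIntg : Integrable (fun t => Real.exp (-w * t) * t ^ (a - 1))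
      (volume.restrict (Ioi (0:ℝ))) := by
    by_contra hn
    rw [integral_undef hn] at e
    linarith
  rw [← e, ofReal_integral_eq_lintegral_ofReal hIntg]
  filter_upwards [ae_restrict_mem measurableSet_Ioi] with t ht
  have : 0 < t := ht
  simp only [Pi.zero_apply]
  positivity

lemma ml_laplace_conv (F K : ℝ → ENNReal) (hF : Measurable F) (hK : Measurable K) :
    ∫⁻ t, ∫⁻ s, F s * K (t - s) = (∫⁻ s, F s) * ∫⁻ u, K u := by
  rw [lintegral_lintegral_swap (by fun_prop)]
  have : ∀ s, ∫⁻ t, F s * K (t - s) = F s * ∫⁻ u, K u := by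
    intro s
    rw [lintegral_const_mul _ (by fun_prop), lintegral_sub_right_eq_self]
  simp_rw [this]
  rw [lintegral_mul_const _ hF]

theorem laplace_mittagLeffler (α v : ℝ) (hα0 : 0 < α) (hα1 : α < 1) (hv : 0 ≤ v) :
    ∀ w : ℝ, 0 < w → 0 < w ^ α + v →
      IntegrableOn (fun t : ℝ => Real.exp (-w * t) * mittagLeffler α (-v * t ^ α)) (Ioi 0) ∧
      ∫ t in Ioi (0 : ℝ), Real.exp (-w * t) * mittagLeffler α (-v * t ^ α)
        = w ^ (α - 1) / (w ^ α + v) := by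
  intro w hw _
  have hf := ml_f_cont α v hα0
  have hf0 : ∀ t, 0 ≤ t → 0 ≤ mittagLeffler α (-v * t ^ α) :=
    fun t ht => ml_nonneg α v t hα0 hα1 hv ht
  have hid := fun t ht => ml_identity α v t hα0 hα1 hv ht
  have hG1 : 0 < Real.Gamma (1 - α) := Real.Gamma_pos_of_pos (by linarith)
  have h1α : 0 < 1 - α := by linarith
  have hwα : 0 < w ^ α := Real.rpow_pos_of_pos hw _
  set f : ℝ → ℝ := fun t => mittagLeffler α (-v * t ^ α) with hfdef
  change ∀ t, 0 ≤ t → 0 ≤ f t at hf0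
  change ∀ t, 0 < t → ∫ s in (0:ℝ)..t, f s * ((t - s) ^ (-α) + v * Real.Gamma (1 - α)) =
    t ^ (1 - α) / (1 - α) at hid
  change IntegrableOn (fun t : ℝ => Real.exp (-w * t) * f t) (Ioi 0) ∧
      ∫ t in Ioi (0 : ℝ), Real.exp (-w * t) * f t = w ^ (α - 1) / (w ^ α + v)
  clear_value f
  set c := v * Real.Gamma (1 - α) with hc
  have hc0 : 0 ≤ c := by positivity
  let F : ℝ → ENNReal := (Ioi (0:ℝ)).indicator fun t => ENNReal.ofReal (Real.exp (-w * t) * f t)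
  let K : ℝ → ENNReal := (Ioi (0:ℝ)).indicator fun t =>
    ENNReal.ofReal (Real.exp (-w * t) * (t ^ (-α) + c))
  have hfm := hf.measurable
  have hF : Measurable F := Measurable.indicator (by fun_prop) measurableSet_Ioi
  have hK : Measurable K := Measurable.indicator (by fun_prop) measurableSet_Ioi
  have hFint : ∫⁻ t, F t = ∫⁻ t in Ioi (0:ℝ), ENNReal.ofReal (Real.exp (-w * t) * f t) :=
    lintegral_indicator measurableSet_Ioi _
  have hKint : ∫⁻ t, K t = ENNReal.ofReal (Real.Gamma (1 - α) * w ^ (α - 1) + c * w⁻¹) := by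
    have h1 := ml_lint_rpow (1 - α) w h1α hw
    have h2 := ml_lint_rpow 1 w one_pos hw
    have e1 : 1 - α - 1 = -α := by ring
    have e2 : -(1 - α) = α - 1 := by ring
    rw [e1, e2] at h1
    simp only [sub_self, Real.rpow_zero, mul_one, Real.Gamma_one, Real.rpow_neg_one] at h2
    rw [show ∫⁻ t, K t = _ from lintegral_indicator measurableSet_Ioi _]
    have : ∀ t ∈ Ioi (0:ℝ), ENNReal.ofReal (Real.exp (-w * t) * (t ^ (-α) + c)) =
        ENNReal.ofReal (Real.exp (-w * t) * t ^ (-α)) +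
          ENNReal.ofReal c * ENNReal.ofReal (Real.exp (-w * t)) := by
      intro t ht
      have ht : 0 < t := ht
      rw [← ENNReal.ofReal_mul hc0, ← ENNReal.ofReal_add (by positivity) (by positivity)]
      congr 1
      ring
    rw [setLIntegral_congr_fun measurableSet_Ioi this, lintegral_add_left (by fun_prop),
      lintegral_const_mul _ (by fun_prop), h1, h2, ← ENNReal.ofReal_mul hc0,
      ← ENNReal.ofReal_add (by positivity) (by positivity)]
    congr 1
    ring
  have hconv : ∀ t, ∫⁻ s, F s * K (t - s) = (Ioi (0:ℝ)).indicator (fun t =>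
      ENNReal.ofReal (1 - α)⁻¹ * ENNReal.ofReal (Real.exp (-w * t) * t ^ (2 - α - 1))) t := by
    intro t
    have hprod : ∀ s, F s * K (t - s) = (Ioo (0:ℝ) t).indicator (fun s =>
        ENNReal.ofReal (Real.exp (-w * t) * (f s * ((t - s) ^ (-α) + c)))) s := by
      intro s
      by_cases hs : s ∈ Ioo 0 t
      · have h1 : s ∈ Ioi (0:ℝ) := hs.1
        have h2 : t - s ∈ Ioi (0:ℝ) := sub_pos.2 hs.2
        have hfs := hf0 s hs.1.le
        simp only [F, K]
        rw [indicator_of_mem hs, indicator_of_mem h1, indicator_of_mem h2,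
          ← ENNReal.ofReal_mul (by positivity)]
        congr 1
        have : Real.exp (-w * t) = Real.exp (-w * s) * Real.exp (-w * (t - s)) := by
          rw [← Real.exp_add]
          congr 1
          ring
        rw [this]
        ring
      · rw [indicator_of_notMem hs]
        simp only [F, K]
        by_cases h1 : s ∈ Ioi (0:ℝ)
        · have h2 : t - s ∉ Ioi (0:ℝ) := fun h => hs ⟨h1, sub_pos.1 h⟩
          rw [indicator_of_notMem h2, mul_zero]
        · rw [indicator_of_notMem h1, zero_mul]
    simp_rw [hprod]
    rw [lintegral_indicator measurableSet_Ioo]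
    by_cases ht : t ∈ Ioi (0:ℝ)
    · rw [indicator_of_mem ht]
      have ht : 0 < t := ht
      have hIntg : IntervalIntegrable (fun s => f s * ((t - s) ^ (-α) + c)) volume 0 t :=
        ((ml_ker_int α t hα1).add intervalIntegrable_const).continuousOn_mul hf.continuousOn
      rw [intervalIntegrable_iff_integrableOn_Ioo_of_le ht.le] at hIntg
      have hidt := hid t ht
      rw [intervalIntegral.integral_of_le ht.le, integral_Ioc_eq_integral_Ioo] at hidt
      rw [← ofReal_integral_eq_lintegral_ofReal (hIntg.const_mul _), integral_const_mul, hidt,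
        ← ENNReal.ofReal_mul (by positivity)]
      · congr 1
        have : 2 - α - 1 = 1 - α := by ring
        rw [this]
        ring
      · filter_upwards [ae_restrict_mem measurableSet_Ioo] with s hs
        have hfs := hf0 s hs.1.le
        have hts : 0 < t - s := sub_pos.2 hs.2
        simp only [Pi.zero_apply]
        positivity
    · rw [indicator_of_notMem ht, Ioo_eq_empty (fun h => ht h)]
      simp
  have hmul := ml_laplace_conv F K hF hK
  simp_rw [hconv] at hmul
  have h2α := ml_lint_rpow (2 - α) w (by linarith) hw
  rw [lintegral_indicator measurableSet_Ioi, lintegral_const_mul _ (by fun_prop), h2α,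
    ← ENNReal.ofReal_mul (by positivity), hKint, hFint] at hmul
  have hKpos : 0 < Real.Gamma (1 - α) * w ^ (α - 1) + c * w⁻¹ := by positivity
  have hval : ∫⁻ t in Ioi (0:ℝ), ENNReal.ofReal (Real.exp (-w * t) * f t) =
      ENNReal.ofReal (w ^ (α - 1) / (w ^ α + v)) := by
    have hne : ENNReal.ofReal (Real.Gamma (1 - α) * w ^ (α - 1) + c * w⁻¹) ≠ 0 :=
      (ENNReal.ofReal_pos.2 hKpos).ne'
    have := (ENNReal.eq_div_iff hne ENNReal.ofReal_ne_top).2 ((mul_comm _ _).trans hmul.symm)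
    rw [this, ← ENNReal.ofReal_div_of_pos hKpos]
    congr 1
    have g2 : Real.Gamma (2 - α) = (1 - α) * Real.Gamma (1 - α) := by
      rw [← Real.Gamma_add_one h1α.ne']
      congr 1
      ring
    have r1 : w ^ (α - 1) = w ^ α / w := Real.rpow_sub_one hw.ne' α
    have r2 : w ^ (-(2 - α)) = w ^ α / w / w := by
      rw [show -(2 - α) = α - 1 - 1 by ring, Real.rpow_sub_one hw.ne', r1]
    have hD : w ^ α + v ≠ 0 := by positivity
    rw [r1] at hKpos
    rw [g2, r1, r2, div_eq_div_iff hKpos.ne' hD, hc]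
    field_simp
  have hnn : 0 ≤ᵐ[volume.restrict (Ioi (0:ℝ))] fun t => Real.exp (-w * t) * f t := by
    filter_upwards [ae_restrict_mem measurableSet_Ioi] with t ht
    have ht : 0 < t := ht
    have := hf0 t ht.le
    simp only [Pi.zero_apply]
    positivity
  have hmeas : AEStronglyMeasurable (fun t => Real.exp (-w * t) * f t)
      (volume.restrict (Ioi (0:ℝ))) := by
    have : Continuous fun t => Real.exp (-w * t) * f t := by fun_prop
    exact this.aestronglyMeasurable
  refine ⟨⟨hmeas, ?_⟩, ?_⟩
  · rw [hasFiniteIntegral_iff_ofReal hnn, hval]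
    exact ENNReal.ofReal_lt_top
  · rw [integral_eq_lintegral_of_nonneg_ae hnn hmeas, hval, ENNReal.toReal_ofReal (by positivity)]
end

section
/- Let 0 < α < 1 and let p : (0,∞) × [0,∞) → ℝ, (t,τ) ↦ p_t(τ), be a measurable family of nonnegative functions satisfying ∫₀^∞ e^{−st} p_t(τ) dt = s^{α−1} e^{−τ s^α} for all s > 0 and τ ≥ 0. Let x : [0,∞) → ℝ be continuously differentiable with x and x′ bounded, and define x_α(t) = ∫₀^∞ p_t(τ) x(τ) dτ. Assume x_α is continuously differentiable on (0,∞), that t ↦ (ᶜD^α_{0+} x_α)(t) and t ↦ ∫₀^∞ p_t(τ) x′(τ) dτ are continuous and of at most exponential order. Then for all t > 0, (ᶜD^α_{0+} x_α)(t) = ∫₀^∞ p_t(τ) x′(τ) dτ. -/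
open MeasureTheory Set

/-- The left Caputo derivative of order `α` with base point `a`. -/
noncomputable def caputoL (a α : ℝ) (f : ℝ → ℝ) (t : ℝ) : ℝ :=
  (Real.Gamma (1 - α))⁻¹ * ∫ τ in a..t, (t - τ) ^ (-α) * deriv f τ

open ProbabilityTheory Filter Topology in
lemma aux_measure_ext (μ ν : Measure ℝ) [IsFiniteMeasure μ] [IsFiniteMeasure ν]
    (hμ : ∀ y : ℝ, y < 1 → Integrable (fun t => Real.exp (y * t)) μ)
    (hν : ∀ y : ℝ, y < 1 → Integrable (fun t => Real.exp (y * t)) ν)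
    (h : ∀ y : ℝ, y < 1 → ∫ t, Real.exp (y * t) ∂μ = ∫ t, Real.exp (y * t) ∂ν) : μ = ν := by
  have hsub : ∀ m : Measure ℝ, (∀ y : ℝ, y < 1 → Integrable (fun t => Real.exp (y * t)) m) →
      Iio (1:ℝ) ⊆ interior (integrableExpSet id m) := by
    intro m hm
    refine interior_maximal ?_ isOpen_Iio
    intro y hy
    exact hm y hy
  have hX : AnalyticOnNhd ℂ (complexMGF id μ) {z | z.re ∈ Iio (1:ℝ)} :=
    analyticOnNhd_complexMGF.mono (fun z hz => hsub μ hμ hz)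
  have hY : AnalyticOnNhd ℂ (complexMGF id ν) {z | z.re ∈ Iio (1:ℝ)} :=
    analyticOnNhd_complexMGF.mono (fun z hz => hsub ν hν hz)
  have hE : EqOn (complexMGF id μ) (complexMGF id ν) {z | z.re ∈ Iio (1:ℝ)} := by
    refine AnalyticOnNhd.eqOn_of_preconnected_of_frequently_eq hX hY
      ((convex_Iio (1:ℝ)).linear_preimage Complex.reLm).isPreconnected
      (z₀ := ((0:ℝ) : ℂ)) (by simp) ?_
    have h_real : ∃ᶠ (x : ℝ) in 𝓝[≠] (0:ℝ), complexMGF id μ x = complexMGF id ν x := by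
      refine Eventually.frequently ?_
      have : ∀ᶠ x : ℝ in 𝓝[≠] (0:ℝ), x < 1 :=
        nhdsWithin_le_nhds (Iio_mem_nhds one_pos)
      filter_upwards [this] with y hy
      rw [complexMGF_ofReal, complexMGF_ofReal]
      have := h y hy
      simp only [mgf, id]
      rw [this]
    rw [frequently_iff_seq_forall] at h_real ⊢
    obtain ⟨xs, hx_tendsto, hx_eq⟩ := h_real
    refine ⟨fun n ↦ xs n, ?_, fun n ↦ ?_⟩
    · rw [tendsto_nhdsWithin_iff] at hx_tendsto ⊢
      constructor
      · refine (Complex.continuous_ofReal.tendsto _).comp ?_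
        exact hx_tendsto.1
      · simpa using hx_tendsto.2
    · simp [hx_eq]
  refine Measure.ext_of_charFun ?_
  ext t
  rw [← complexMGF_id_mul_I, ← complexMGF_id_mul_I]
  exact hE (by simp)

lemma aux_laplace_inj (d : ℝ → ℝ)
    (hd : ∀ s : ℝ, 0 < s → IntegrableOn (fun t => Real.exp (-s * t) * d t) (Ioi 0))
    (h0 : ∀ s : ℝ, 0 < s → ∫ t in Ioi (0:ℝ), Real.exp (-s * t) * d t = 0) :
    ∀ᵐ t ∂(volume.restrict (Ioi (0:ℝ))), d t = 0 := by
  set m := volume.restrict (Ioi (0:ℝ)) with hm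
  set D : ℝ → ℝ := fun t => Real.exp (-1 * t) * d t with hD
  have hDi : Integrable D m := hd 1 one_pos
  have hae : AEMeasurable (fun t => ENNReal.ofReal (D t)) m := hDi.1.aemeasurable.ennreal_ofReal
  have hae' : AEMeasurable (fun t => ENNReal.ofReal (-D t)) m :=
    hDi.1.aemeasurable.neg.ennreal_ofReal
  have e1 : ∀ y t : ℝ, (ENNReal.ofReal (D t)).toReal • Real.exp (y * t)
      = max (Real.exp (-(1-y) * t) * d t) 0 := by
    intro y t
    rw [ENNReal.toReal_ofReal', smul_eq_mul, max_mul_of_nonneg _ _ (Real.exp_pos _).le, zero_mul]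
    congr 1
    rw [hD]; simp only
    rw [mul_right_comm, ← Real.exp_add]; ring_nf
  have e2 : ∀ y t : ℝ, (ENNReal.ofReal (-D t)).toReal • Real.exp (y * t)
      = max (-(Real.exp (-(1-y) * t) * d t)) 0 := by
    intro y t
    rw [ENNReal.toReal_ofReal', smul_eq_mul, max_mul_of_nonneg _ _ (Real.exp_pos _).le, zero_mul]
    congr 1
    rw [hD]; simp only
    rw [neg_mul, mul_right_comm, ← Real.exp_add]; ring_nf
  have : IsFiniteMeasure (m.withDensity (fun t => ENNReal.ofReal (D t))) :=
    isFiniteMeasure_withDensity_ofReal hDi.2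
  have : IsFiniteMeasure (m.withDensity (fun t => ENNReal.ofReal (-D t))) :=
    isFiniteMeasure_withDensity_ofReal hDi.neg.2
  have key : m.withDensity (fun t => ENNReal.ofReal (D t))
      = m.withDensity (fun t => ENNReal.ofReal (-D t)) := by
    apply aux_measure_ext
    · intro y hy
      rw [integrable_withDensity_iff_integrable_smul₀' hae (by simp)]
      simp_rw [e1]
      exact (hd (1-y) (by linarith)).pos_part
    · intro y hy
      rw [integrable_withDensity_iff_integrable_smul₀' hae' (by simp)]
      simp_rw [e2]
      exact (hd (1-y) (by linarith)).neg_part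
    · intro y hy
      rw [integral_withDensity_eq_integral_toReal_smul₀ hae (by simp),
        integral_withDensity_eq_integral_toReal_smul₀ hae' (by simp)]
      simp_rw [e1, e2]
      have hi := hd (1-y) (by linarith)
      rw [← sub_eq_zero, ← integral_sub hi.pos_part hi.neg_part]
      refine Eq.trans ?_ (h0 (1-y) (by linarith))
      refine integral_congr_ae (.of_forall fun t => ?_)
      exact max_zero_sub_max_neg_zero_eq_self (Real.exp (-(1-y) * t) * d t)
  rw [withDensity_eq_iff_of_sigmaFinite hae hae'] at key
  filter_upwards [key] with t ht
  have h1 : D t = 0 := by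
    have := congrArg ENNReal.toReal ht
    rw [ENNReal.toReal_ofReal', ENNReal.toReal_ofReal'] at this
    rcases le_total (D t) 0 with h | h
    · rw [max_eq_right h, max_eq_left (by linarith)] at this; linarith
    · rw [max_eq_left h, max_eq_right (by linarith)] at this; linarith
  simpa [hD] using h1

lemma aux_ae_le (f g : ℝ → ℝ) (hf : ContinuousOn f (Ioi 0)) (hg : ContinuousOn g (Ioi 0))
    (h : ∀ᵐ t ∂(volume.restrict (Ioi (0:ℝ))), f t ≤ g t) : ∀ t, 0 < t → f t ≤ g t := by
  have h' : (fun t => max (f t) (g t)) =ᵐ[volume.restrict (Ioi (0:ℝ))] g := by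
    filter_upwards [h] with t ht using max_eq_right ht
  have := Measure.eqOn_open_of_ae_eq h' isOpen_Ioi (hf.sup hg) hg
  intro t ht
  exact max_eq_right_iff.1 (this ht)

open Filter Topology in
lemma aux_deriv_le (F G : ℝ → ℝ) (F' G' a K : ℝ) (hF : HasDerivAt F F' a) (hG : HasDerivAt G G' a)
    (h : ∀ᶠ l in 𝓝 a, |F l - F a| ≤ K * |G l - G a|) : |F'| ≤ K * |G'| := by
  rw [hasDerivAt_iff_tendsto_slope] at hF hG
  refine le_of_tendsto_of_tendsto hF.abs (hG.abs.const_mul K) ?_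
  filter_upwards [nhdsWithin_le_nhds h, self_mem_nhdsWithin] with l hl hne
  simp only [slope_def_field, abs_div]
  have : 0 < |l - a| := abs_pos.2 (sub_ne_zero.2 hne)
  rw [← mul_div_assoc]
  gcongr

/-- Laplace transform of averages -/
lemma aux_lap_avg (α : ℝ) (p : ℝ → ℝ → ℝ)
    (hmeas : Measurable (Function.uncurry p))
    (hnonneg : ∀ t τ : ℝ, 0 < t → 0 ≤ τ → 0 ≤ p t τ)
    (hlap : ∀ s τ : ℝ, 0 < s → 0 ≤ τ →
      IntegrableOn (fun t : ℝ => Real.exp (-s * t) * p t τ) (Ioi 0) ∧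
      ∫ t in Ioi (0 : ℝ), Real.exp (-s * t) * p t τ = s ^ (α - 1) * Real.exp (-τ * s ^ α))
    (φ : ℝ → ℝ) (hφm : Measurable φ)
    (hφ : ∀ s : ℝ, 0 < s → IntegrableOn (fun τ => φ τ * Real.exp (-τ * s ^ α)) (Ioi 0)) :
    (∀ᵐ t ∂(volume.restrict (Ioi (0:ℝ))), IntegrableOn (fun τ => p t τ * φ τ) (Ioi 0)) ∧
    ∀ s : ℝ, 0 < s →
      IntegrableOn (fun t => Real.exp (-s * t) * ∫ τ in Ioi (0:ℝ), p t τ * φ τ) (Ioi 0) ∧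
      ∫ t in Ioi (0:ℝ), Real.exp (-s * t) * ∫ τ in Ioi (0:ℝ), p t τ * φ τ
        = s ^ (α - 1) * ∫ τ in Ioi (0:ℝ), φ τ * Real.exp (-τ * s ^ α) := by
  set m := volume.restrict (Ioi (0:ℝ)) with hm
  have main : ∀ s : ℝ, 0 < s → Integrable
      (fun z : ℝ × ℝ => Real.exp (-s * z.1) * (p z.1 z.2 * φ z.2)) (m.prod m) := by
    intro s hs
    have hpm : Measurable (fun z : ℝ × ℝ => p z.1 z.2) := hmeas
    rw [integrable_prod_iff' (by fun_prop)]
    constructor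
    · refine (ae_restrict_mem measurableSet_Ioi).mono fun τ hτ => ?_
      have := (hlap s τ hs (le_of_lt hτ)).1.mul_const (φ τ)
      simpa [mul_assoc] using this
    · have := ((hφ s hs).norm.const_mul (s ^ (α-1)))
      refine this.congr ?_
      refine (ae_restrict_mem measurableSet_Ioi).mono fun τ hτ => ?_
      have h2 := (hlap s τ hs (le_of_lt hτ)).2
      simp only [norm_mul, Real.norm_eq_abs, Real.abs_exp]
      rw [mul_left_comm, ← h2, ← integral_const_mul]
      refine setIntegral_congr_fun measurableSet_Ioi fun t ht => ?_
      simp only [abs_of_nonneg (hnonneg t τ ht (le_of_lt hτ))]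
      ring
  constructor
  · filter_upwards [(main 1 one_pos).prod_right_ae] with t ht
    have := ht.const_mul (Real.exp (-1 * t))⁻¹
    simpa [IntegrableOn] using this
  · intro s hs
    have e : ∀ t, Real.exp (-s * t) * ∫ τ, p t τ * φ τ ∂m
        = ∫ τ, Real.exp (-s * t) * (p t τ * φ τ) ∂m := by
      intro t; rw [integral_const_mul]
    simp only [e]
    refine ⟨(main s hs).integral_prod_left, ?_⟩
    rw [integral_integral_swap (f := fun t τ => Real.exp (-s * t) * (p t τ * φ τ)) (main s hs),
      ← integral_const_mul]
    refine setIntegral_congr_fun measurableSet_Ioi fun τ hτ => ?_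
    have h2 := (hlap s τ hs (le_of_lt hτ)).2
    simp only [← mul_assoc]
    rw [integral_mul_const, h2]; ring

lemma aux_gamma (a s : ℝ) (ha : 0 < a) (hs : 0 < s) :
    IntegrableOn (fun t => Real.exp (-s * t) * t ^ (a - 1)) (Ioi 0) ∧
    ∫ t in Ioi (0:ℝ), Real.exp (-s * t) * t ^ (a - 1) = Real.Gamma a * s ^ (-a) := by
  constructor
  · have := integrableOn_rpow_mul_exp_neg_mul_rpow (p := 1) (s := a - 1) (b := s)
      (by linarith) one_pos hs
    simpa [mul_comm] using this
  · have := Real.integral_rpow_mul_exp_neg_mul_Ioi ha hs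
    rw [one_div, Real.inv_rpow hs.le, ← Real.rpow_neg hs.le, mul_comm] at this
    rw [← this]
    refine setIntegral_congr_fun measurableSet_Ioi fun t ht => ?_
    simp only [neg_mul]; rw [mul_comm]

lemma aux_bdd (φ : ℝ → ℝ) (hφ : Measurable φ) (M b : ℝ) (hb : 0 < b)
    (hM : ∀ τ, 0 ≤ τ → |φ τ| ≤ M) :
    IntegrableOn (fun τ => φ τ * Real.exp (-τ * b)) (Ioi 0) := by
  have h1 : IntegrableOn (fun τ => M * Real.exp (-τ * b)) (Ioi 0) := by
    have : IntegrableOn _ (Ioi (0:ℝ)) := (integrableOn_exp_mul_Ioi (a := -b) (by linarith) 0).const_mul M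
    refine this.congr_fun (fun t _ => ?_) measurableSet_Ioi
    simp only; ring_nf
  refine Integrable.mono' h1 (by fun_prop) ?_
  refine (ae_restrict_mem measurableSet_Ioi).mono fun τ hτ => ?_
  rw [norm_mul, Real.norm_eq_abs, Real.norm_eq_abs, Real.abs_exp]
  exact mul_le_mul_of_nonneg_right (hM τ (le_of_lt hτ)) (Real.exp_pos _).le

lemma aux_lap_caputo (α s : ℝ) (hα1 : α < 1) (hs : 0 < s) (f : ℝ → ℝ)
    (hf : IntegrableOn (fun t => Real.exp (-s * t) * deriv f t) (Ioi 0)) :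
    IntegrableOn (fun t => Real.exp (-s * t) * caputoL 0 α f t) (Ioi 0) ∧
    ∫ t in Ioi (0:ℝ), Real.exp (-s * t) * caputoL 0 α f t
      = s ^ (α - 1) * ∫ t in Ioi (0:ℝ), Real.exp (-s * t) * deriv f t := by
  obtain ⟨g1, g2⟩ := aux_gamma (1 - α) s (by linarith) hs
  have hΓ : Real.Gamma (1 - α) ≠ 0 := (Real.Gamma_pos_of_pos (by linarith)).ne'
  have e : ∀ t, Real.exp (-s * t) * caputoL 0 α f t = (Real.Gamma (1 - α))⁻¹ *
      ∫ u in (0:ℝ)..t, (ContinuousLinearMap.mul ℝ ℝ) (Real.exp (-s * u) * deriv f u)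
        (Real.exp (-s * (t - u)) * (t - u) ^ (1 - α - 1)) := by
    intro t
    rw [caputoL, mul_left_comm, ← intervalIntegral.integral_const_mul]
    congr 1
    refine intervalIntegral.integral_congr fun u _ => ?_
    simp only [ContinuousLinearMap.mul_apply']
    rw [show -s * t = -s * u + -s * (t - u) by ring, Real.exp_add,
      show 1 - α - 1 = -α by ring]
    ring
  constructor
  · have := (integrable_posConvolution (μ := volume) (ν := volume) hf g1
      (ContinuousLinearMap.mul ℝ ℝ))
    rw [posConvolution, integrable_indicator_iff measurableSet_Ioi] at this
    simp only [e]
    exact this.const_mul _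
  · simp only [e]
    rw [integral_const_mul, integral_posConvolution hf g1 (ContinuousLinearMap.mul ℝ ℝ), g2]
    simp only [ContinuousLinearMap.mul_apply']
    rw [show -(1 - α) = α - 1 by ring]
    field_simp

lemma aux_laplace_eq (f g : ℝ → ℝ)
    (hf : ∀ s : ℝ, 0 < s → IntegrableOn (fun t => Real.exp (-s * t) * f t) (Ioi 0))
    (hg : ∀ s : ℝ, 0 < s → IntegrableOn (fun t => Real.exp (-s * t) * g t) (Ioi 0))
    (h : ∀ s : ℝ, 0 < s → ∫ t in Ioi (0:ℝ), Real.exp (-s * t) * f t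
      = ∫ t in Ioi (0:ℝ), Real.exp (-s * t) * g t) :
    ∀ᵐ t ∂(volume.restrict (Ioi (0:ℝ))), f t = g t := by
  have := aux_laplace_inj (fun t => f t - g t) ?_ ?_
  · filter_upwards [this] with t ht using sub_eq_zero.1 ht
  · intro s hs
    simp only [mul_sub]
    exact (hf s hs).sub (hg s hs)
  · intro s hs
    simp only [mul_sub]
    rw [integral_sub (hf s hs) (hg s hs), h s hs, sub_self]

lemma aux_moment (α : ℝ) (hα0 : 0 < α) (p : ℝ → ℝ → ℝ)
    (hmeas : Measurable (Function.uncurry p))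
    (hnonneg : ∀ t τ : ℝ, 0 < t → 0 ≤ τ → 0 ≤ p t τ)
    (hlap : ∀ s τ : ℝ, 0 < s → 0 ≤ τ →
      IntegrableOn (fun t : ℝ => Real.exp (-s * t) * p t τ) (Ioi 0) ∧
      ∫ t in Ioi (0 : ℝ), Real.exp (-s * t) * p t τ = s ^ (α - 1) * Real.exp (-τ * s ^ α))
    (k : ℝ) (hk : 1 ≤ k) :
    ∀ᵐ t ∂(volume.restrict (Ioi (0:ℝ))), IntegrableOn (fun τ => p t τ * τ ^ (k - 1)) (Ioi 0) ∧
      ∫ τ in Ioi (0:ℝ), p t τ * τ ^ (k - 1)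
        = Real.Gamma k / Real.Gamma (1 + (k - 1) * α) * t ^ ((k - 1) * α) := by
  have hk1 : 0 ≤ (k - 1) * α := mul_nonneg (by linarith) hα0.le
  have hφ : ∀ s : ℝ, 0 < s →
      IntegrableOn (fun τ : ℝ => τ ^ (k - 1) * Real.exp (-τ * s ^ α)) (Ioi 0) := by
    intro s hs
    have := (aux_gamma k (s ^ α) (by linarith) (Real.rpow_pos_of_pos hs _)).1
    refine this.congr_fun (fun t _ => ?_) measurableSet_Ioi
    simp only; rw [mul_comm]; ring_nf
  obtain ⟨h1, h2⟩ := aux_lap_avg α p hmeas hnonneg hlap (fun τ => τ ^ (k - 1)) (by fun_prop) hφ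
  have hg : ∀ s : ℝ, 0 < s →
      IntegrableOn (fun t : ℝ => Real.exp (-s * t) *
        (Real.Gamma k / Real.Gamma (1 + (k - 1) * α) * t ^ ((k - 1) * α))) (Ioi 0) ∧
      ∫ t in Ioi (0:ℝ), Real.exp (-s * t) *
        (Real.Gamma k / Real.Gamma (1 + (k - 1) * α) * t ^ ((k - 1) * α)) =
        Real.Gamma k * s ^ (-(1 + (k - 1) * α)) := by
    intro s hs
    obtain ⟨a1, a2⟩ := aux_gamma (1 + (k - 1) * α) s (by linarith) hs
    rw [add_sub_cancel_left] at a1 a2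
    simp only [mul_left_comm (Real.exp _)]
    refine ⟨a1.const_mul _, ?_⟩
    rw [integral_const_mul, a2]
    have := (Real.Gamma_pos_of_pos (s := 1 + (k - 1) * α) (by linarith)).ne'
    field_simp
  have h3 := aux_laplace_eq _ _ (fun s hs => (h2 s hs).1) (fun s hs => (hg s hs).1) ?_
  · filter_upwards [h1, h3] with t ht1 ht3 using ⟨ht1, ht3⟩
  · intro s hs
    rw [(h2 s hs).2, (hg s hs).2]
    have := (aux_gamma k (s ^ α) (by linarith) (Real.rpow_pos_of_pos hs _)).2
    have e : ∫ τ in Ioi (0:ℝ), τ ^ (k - 1) * Real.exp (-τ * s ^ α)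
        = Real.Gamma k * (s ^ α) ^ (-k) := by
      rw [← this]
      refine setIntegral_congr_fun measurableSet_Ioi fun t ht => ?_
      rw [mul_comm]; ring_nf
    rw [e, ← Real.rpow_mul hs.le, mul_left_comm, ← Real.rpow_add hs]
    congr 2; ring

open Filter Topology in
lemma aux_ibp (x : ℝ → ℝ) (hx : ContDiff ℝ 1 x) (M b : ℝ) (hb : 0 < b)
    (hM : ∀ τ : ℝ, 0 ≤ τ → |x τ| ≤ M ∧ |deriv x τ| ≤ M) :
    ∫ τ in Ioi (0:ℝ), deriv x τ * Real.exp (-τ * b)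
      = b * (∫ τ in Ioi (0:ℝ), x τ * Real.exp (-τ * b)) - x 0 := by
  have i1 := aux_bdd x hx.continuous.measurable M b hb (fun τ h => (hM τ h).1)
  have i2 := aux_bdd (deriv x) (measurable_deriv x) M b hb (fun τ h => (hM τ h).2)
  have hd : ∀ τ ∈ Ici (0:ℝ), HasDerivAt (fun τ => x τ * Real.exp (-τ * b))
      (deriv x τ * Real.exp (-τ * b) - b * (x τ * Real.exp (-τ * b))) τ := by
    intro τ _
    have h1 := (hx.differentiable (by simp) τ).hasDerivAt
    have h2 : HasDerivAt (fun τ : ℝ => Real.exp (-τ * b)) (Real.exp (-τ * b) * (-1 * b)) τ :=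
      (((hasDerivAt_id τ).neg).mul_const b).exp
    exact (h1.mul h2).congr_deriv (by ring)
  have hexp : Tendsto (fun τ : ℝ => M * Real.exp (-τ * b)) atTop (𝓝 0) := by
    have := tendsto_rpow_mul_exp_neg_mul_atTop_nhds_zero 0 b hb
    have := this.const_mul M
    simp only [Real.rpow_zero, one_mul, mul_zero] at this
    refine this.congr fun τ => ?_
    rw [neg_mul, neg_mul, mul_comm b]
  have ht : Tendsto (fun τ => x τ * Real.exp (-τ * b)) atTop (𝓝 0) := by
    refine squeeze_zero_norm' ?_ hexp
    filter_upwards [eventually_ge_atTop 0] with τ hτ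
    rw [norm_mul, Real.norm_eq_abs, Real.norm_eq_abs, Real.abs_exp]
    exact mul_le_mul_of_nonneg_right (hM τ hτ).1 (Real.exp_pos _).le
  have := integral_Ioi_of_hasDerivAt_of_tendsto' hd (i2.sub (i1.const_mul b)) ht
  rw [integral_sub i2 (i1.const_mul b), integral_const_mul] at this
  simp at this
  simp
  linarith

open Filter Topology in
/-- Laplace transform of a derivative, with a power bound at the origin. -/
lemma aux_lap_deriv (α s K c : ℝ) (hα0 : 0 < α) (hs : 0 < s) (f : ℝ → ℝ)
    (hf : ContDiffOn ℝ 1 f (Ioi 0))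
    (hfi : IntegrableOn (fun t => Real.exp (-s * t) * f t) (Ioi 0))
    (h0 : ∀ t : ℝ, 0 < t → |f t - c| ≤ K * t ^ α)
    (h1 : ∀ t : ℝ, 0 < t → |deriv f t| ≤ K * t ^ (α - 1)) :
    IntegrableOn (fun t => Real.exp (-s * t) * deriv f t) (Ioi 0) ∧
    ∫ t in Ioi (0:ℝ), Real.exp (-s * t) * deriv f t
      = s * (∫ t in Ioi (0:ℝ), Real.exp (-s * t) * f t) - c := by
  have hfd : ∀ t ∈ Ioi (0:ℝ), HasDerivAt f (deriv f t) t := fun t ht =>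
    ((hf.differentiableOn (by simp)).differentiableAt (isOpen_Ioi.mem_nhds ht)).hasDerivAt
  have hi' : IntegrableOn (fun t => Real.exp (-s * t) * deriv f t) (Ioi 0) := by
    refine Integrable.mono' ((aux_gamma α s hα0 hs).1.const_mul K) ?_ ?_
    · have := measurable_deriv f
      exact (by fun_prop : Measurable (fun t => Real.exp (-s * t) * deriv f t)).aestronglyMeasurable
    · refine (ae_restrict_mem measurableSet_Ioi).mono fun t ht => ?_
      rw [norm_mul, Real.norm_eq_abs, Real.norm_eq_abs, Real.abs_exp, mul_left_comm K]
      exact mul_le_mul_of_nonneg_left (h1 t ht) (Real.exp_pos _).le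
  refine ⟨hi', ?_⟩
  have hc := aux_gamma 1 s one_pos hs
  simp only [sub_self, Real.rpow_zero, mul_one, Real.Gamma_one, one_mul] at hc
  have hfi' : IntegrableOn (fun t => Real.exp (-s * t) * (f t - c)) (Ioi 0) := by
    simp only [mul_sub]
    exact hfi.sub (hc.1.mul_const c)
  have hu : ∀ t ∈ Ioi (0:ℝ), HasDerivAt (fun t => Real.exp (-s * t)) (-s * Real.exp (-s * t)) t := by
    intro t _
    have : HasDerivAt (fun t : ℝ => Real.exp (-s * t)) (Real.exp (-s * t) * (-s * 1)) t :=
      ((hasDerivAt_id t).const_mul (-s)).exp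
    convert this using 1; ring
  have hbd : ∀ t : ℝ, 0 < t → ‖Real.exp (-s * t) * (f t - c)‖ ≤ K * (t ^ α * Real.exp (-s * t)) := by
    intro t ht
    rw [norm_mul, Real.norm_eq_abs, Real.norm_eq_abs, Real.abs_exp, ← mul_assoc, mul_comm]
    exact mul_le_mul_of_nonneg_right (h0 t ht) (Real.exp_pos _).le
  have key := integral_Ioi_mul_deriv_eq_deriv_mul (a := (0:ℝ)) (a' := (0:ℝ)) (b' := (0:ℝ))
    (u := fun t => Real.exp (-s * t)) (v := fun t => f t - c) hu
    (fun t ht => (hfd t ht).sub_const c) hi' ?_ ?_ ?_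
  · rw [key]
    simp only [mul_assoc, mul_sub (Real.exp _)]
    rw [integral_const_mul, integral_sub hfi (hc.1.mul_const c), integral_mul_const, hc.2,
      Real.rpow_neg_one]
    field_simp
    ring
  · have := hfi'.const_mul (-s)
    simp only [← mul_assoc] at this
    exact this
  · have hT : Tendsto (fun t : ℝ => K * (t ^ α * Real.exp (-s * t))) (𝓝[>] 0) (𝓝 0) := by
      have : ContinuousAt (fun t : ℝ => K * (t ^ α * Real.exp (-s * t))) 0 := by
        refine continuousAt_const.mul (ContinuousAt.mul ?_ (by fun_prop))
        exact Real.continuousAt_rpow_const _ _ (Or.inr hα0.le)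
      have := this.tendsto
      simp only [Real.zero_rpow hα0.ne', zero_mul, mul_zero] at this
      exact this.mono_left nhdsWithin_le_nhds
    refine squeeze_zero_norm' ?_ hT
    filter_upwards [self_mem_nhdsWithin] with t ht using hbd t ht
  · have hT := (tendsto_rpow_mul_exp_neg_mul_atTop_nhds_zero α s hs).const_mul K
    rw [mul_zero] at hT
    refine squeeze_zero_norm' ?_ hT
    filter_upwards [eventually_gt_atTop 0] with t ht using hbd t ht

lemma aux_lip (x : ℝ → ℝ) (hx : ContDiff ℝ 1 x) (M : ℝ)
    (hM : ∀ τ : ℝ, 0 ≤ τ → |x τ| ≤ M ∧ |deriv x τ| ≤ M) (a b : ℝ) (ha : 0 ≤ a) (hb : 0 ≤ b) :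
    |x a - x b| ≤ M * |a - b| := by
  have := (convex_Ici (0:ℝ)).norm_image_sub_le_of_norm_deriv_le (f := x) (C := M)
    (fun t _ => hx.differentiable (by simp) t) (fun t ht => (hM t ht).2) (mem_Ici.2 hb) (mem_Ici.2 ha)
  simpa using this

/-- the Caputo derivative of the time-averaged trajectory equals the
time average of the classical derivative:
`(ᶜD^α_{0+} x_α)(t) = ∫₀^∞ p_t(τ) x′(τ) dτ` for all `t > 0`. -/
theorem caputo_time_averaged (α : ℝ) (hα0 : 0 < α) (hα1 : α < 1)
    (p : ℝ → ℝ → ℝ)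
    (hmeas : Measurable (Function.uncurry p))
    (hnonneg : ∀ t τ : ℝ, 0 < t → 0 ≤ τ → 0 ≤ p t τ)
    (hlap : ∀ s τ : ℝ, 0 < s → 0 ≤ τ →
      IntegrableOn (fun t : ℝ => Real.exp (-s * t) * p t τ) (Ioi 0) ∧
      ∫ t in Ioi (0 : ℝ), Real.exp (-s * t) * p t τ = s ^ (α - 1) * Real.exp (-τ * s ^ α))
    (x : ℝ → ℝ) (hx : ContDiff ℝ 1 x)
    (hxb : ∃ M : ℝ, ∀ τ : ℝ, 0 ≤ τ → |x τ| ≤ M ∧ |deriv x τ| ≤ M)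
    (xα : ℝ → ℝ)
    (hint : ∀ t : ℝ, 0 < t →
      IntegrableOn (fun τ : ℝ => p t τ * x τ) (Ioi 0) ∧
      IntegrableOn (fun τ : ℝ => p t τ * deriv x τ) (Ioi 0))
    (hxα : ∀ t : ℝ, 0 < t → xα t = ∫ τ in Ioi (0 : ℝ), p t τ * x τ)
    (hxαC : ContDiffOn ℝ 1 xα (Ioi 0))
    (hcont1 : ContinuousOn (fun t : ℝ => caputoL 0 α xα t) (Ioi 0))
    (hexp1 : ∃ M c : ℝ, ∀ t : ℝ, 0 < t → |caputoL 0 α xα t| ≤ M * Real.exp (c * t))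
    (hcont2 : ContinuousOn (fun t : ℝ => ∫ τ in Ioi (0 : ℝ), p t τ * deriv x τ) (Ioi 0))
    (hexp2 : ∃ M c : ℝ, ∀ t : ℝ, 0 < t →
      |∫ τ in Ioi (0 : ℝ), p t τ * deriv x τ| ≤ M * Real.exp (c * t)) :
    ∀ t : ℝ, 0 < t → caputoL 0 α xα t = ∫ τ in Ioi (0 : ℝ), p t τ * deriv x τ := by
  obtain ⟨M, hM⟩ := hxb
  have hM0 : 0 ≤ M := (abs_nonneg _).trans (hM 0 le_rfl).1
  have hxm : Measurable x := hx.continuous.measurable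
  have hpow : ∀ s : ℝ, 0 < s → 0 < s ^ α := fun s hs => Real.rpow_pos_of_pos hs _
  obtain ⟨-, hLx⟩ := aux_lap_avg α p hmeas hnonneg hlap x hxm
    (fun s hs => aux_bdd x hxm M _ (hpow s hs) (fun τ h => (hM τ h).1))
  obtain ⟨-, hLg⟩ := aux_lap_avg α p hmeas hnonneg hlap (deriv x) (measurable_deriv x)
    (fun s hs => aux_bdd _ (measurable_deriv x) M _ (hpow s hs) (fun τ h => (hM τ h).2))
  have hLh : ∀ s : ℝ, 0 < s → IntegrableOn (fun t => Real.exp (-s * t) * xα t) (Ioi 0) ∧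
      ∫ t in Ioi (0:ℝ), Real.exp (-s * t) * xα t
        = s ^ (α - 1) * ∫ τ in Ioi (0:ℝ), x τ * Real.exp (-τ * s ^ α) := by
    intro s hs
    have e : EqOn (fun t => Real.exp (-s * t) * ∫ τ in Ioi (0:ℝ), p t τ * x τ)
        (fun t => Real.exp (-s * t) * xα t) (Ioi 0) := fun t ht => by
      simp only [hxα t ht]
    exact ⟨(hLx s hs).1.congr_fun e measurableSet_Ioi,
      (setIntegral_congr_fun measurableSet_Ioi e).symm.trans (hLx s hs).2⟩
  -- moments
  have m1 := aux_moment α hα0 p hmeas hnonneg hlap 1 le_rfl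
  have m2 := aux_moment α hα0 p hmeas hnonneg hlap 2 one_le_two
  have e21 : (2:ℝ) - 1 = 1 := by norm_num
  simp only [sub_self, Real.rpow_zero, mul_one, zero_mul, add_zero, Real.Gamma_one, div_one] at m1
  simp only [e21, Real.rpow_one, one_mul, Real.Gamma_two] at m2
  set C : ℝ := 1 / Real.Gamma (1 + α) with hC
  have hC0 : 0 ≤ C := by
    have := Real.Gamma_pos_of_pos (s := 1 + α) (by linarith)
    positivity
  have hcont : ContinuousOn xα (Ioi 0) := hxαC.continuousOn
  -- averaging of Lipschitz-type bounds
  have avg : ∀ (φ : ℝ → ℝ) (N t : ℝ), 0 < t → (∀ τ, 0 < τ → |φ τ| ≤ N * τ) →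
      IntegrableOn (fun τ => p t τ * τ) (Ioi 0) →
      ∫ τ in Ioi (0:ℝ), p t τ * τ = C * t ^ α →
      |∫ τ in Ioi (0:ℝ), p t τ * φ τ| ≤ N * (C * t ^ α) := by
    intro φ N t ht hφ hi he
    rw [← he, ← integral_const_mul, ← Real.norm_eq_abs]
    refine norm_integral_le_of_norm_le (hi.const_mul N) ?_
    refine (ae_restrict_mem measurableSet_Ioi).mono fun τ hτ => ?_
    have hp := hnonneg t τ ht (le_of_lt hτ)
    rw [norm_mul, Real.norm_eq_abs, Real.norm_eq_abs, abs_of_nonneg hp, mul_left_comm N]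
    exact mul_le_mul_of_nonneg_left (hφ τ hτ) hp
  have contpow : ∀ N : ℝ, ContinuousOn (fun t : ℝ => N * (C * t ^ α)) (Ioi 0) := by
    intro N
    refine continuousOn_const.mul (continuousOn_const.mul ?_)
    exact (Real.continuous_rpow_const hα0.le).continuousOn
  -- behaviour at zero
  have b0 : ∀ t : ℝ, 0 < t → |xα t - x 0| ≤ M * (C * t ^ α) := by
    refine aux_ae_le _ _ (hcont.sub continuousOn_const).abs (contpow M) ?_
    filter_upwards [m1, m2, ae_restrict_mem measurableSet_Ioi] with t h1 h2 ht
    have e : xα t - x 0 = ∫ τ in Ioi (0:ℝ), p t τ * (x τ - x 0) := by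
      simp only [mul_sub]
      rw [integral_sub (hint t ht).1 (h1.1.mul_const _), integral_mul_const, h1.2, one_mul,
        hxα t ht]
    rw [e]
    refine avg _ M t ht (fun τ hτ => ?_) h2.1 h2.2
    have := aux_lip x hx M hM τ 0 hτ.le le_rfl
    rwa [sub_zero, abs_of_pos hτ] at this
  -- scaling
  have bs : ∀ l : ℝ, 0 < l → ∀ t : ℝ, 0 < t →
      |xα (l * t) - xα t| ≤ (M * |l ^ α - 1|) * (C * t ^ α) := by
    intro l hl
    have hc := hpow l hl
    refine aux_ae_le _ _ ?_ (contpow _) ?_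
    · refine (ContinuousOn.sub ?_ hcont).abs
      exact hcont.comp (by fun_prop) (fun t ht => mul_pos hl ht)
    have hym : Measurable (fun τ => x (l ^ α * τ)) := by fun_prop
    obtain ⟨hyi, hLy⟩ := aux_lap_avg α p hmeas hnonneg hlap (fun τ => x (l ^ α * τ)) hym
      (fun s hs => aux_bdd _ hym M _ (hpow s hs) (fun τ h => (hM _ (by positivity)).1))
    have hsc : ∀ s t : ℝ, Real.exp (-s * t) * xα (l * t)
        = (fun u => Real.exp (-(s / l) * u) * xα u) (l * t) := by
      intro s t
      simp only
      congr 2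
      field_simp
    have hEq := aux_laplace_eq (fun t => xα (l * t)) _ ?_ (fun s hs => (hLy s hs).1) ?_
    · filter_upwards [hEq, hyi, m2, ae_restrict_mem measurableSet_Ioi] with t h1 hyt h2 ht
      have e : xα (l * t) - xα t = ∫ τ in Ioi (0:ℝ), p t τ * (x (l ^ α * τ) - x τ) := by
        simp only [mul_sub]
        rw [integral_sub hyt (hint t ht).1, h1, hxα t ht]
      rw [e]
      refine avg _ _ t ht (fun τ hτ => ?_) h2.1 h2.2
      have := aux_lip x hx M hM (l ^ α * τ) τ (by positivity) hτ.le
      rwa [show l ^ α * τ - τ = (l ^ α - 1) * τ by ring, abs_mul, abs_of_pos hτ,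
        ← mul_assoc] at this
    · intro s hs
      simp only [hsc s]
      have := (integrableOn_Ioi_comp_mul_left_iff (fun u => Real.exp (-(s / l) * u) * xα u) 0 hl).2
      rw [mul_zero] at this
      exact this (hLh (s / l) (by positivity)).1
    · intro s hs
      rw [(hLy s hs).2]
      simp only [hsc s]
      rw [integral_comp_mul_left_Ioi (fun u => Real.exp (-(s / l) * u) * xα u) 0 hl, mul_zero,
        (hLh (s / l) (by positivity)).2]
      have e2 : ∀ τ : ℝ, x (l ^ α * τ) * Real.exp (-τ * s ^ α)
          = (fun u => x u * Real.exp (-u * (s / l) ^ α)) (l ^ α * τ) := by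
        intro τ
        simp only
        rw [Real.div_rpow hs.le hl.le]
        congr 2
        field_simp
      simp only [e2]
      rw [integral_comp_mul_left_Ioi (fun u => x u * Real.exp (-u * (s / l) ^ α)) 0 hc, mul_zero]
      simp only [smul_eq_mul]
      rw [← mul_assoc, ← mul_assoc]
      congr 1
      rw [Real.div_rpow hs.le hl.le, Real.rpow_sub hl, Real.rpow_one]
      field_simp
  -- derivative bound
  have b1 : ∀ t : ℝ, 0 < t → |deriv xα t| ≤ M * C * t ^ (α - 1) := by
    intro t ht
    have hd : HasDerivAt xα (deriv xα t) t :=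
      ((hxαC.differentiableOn (by simp)).differentiableAt (isOpen_Ioi.mem_nhds ht)).hasDerivAt
    have hF : HasDerivAt (fun l : ℝ => xα (l * t)) (deriv xα t * (1 * t)) 1 := by
      have h2 : HasDerivAt (fun l : ℝ => l * t) (1 * t) 1 := (hasDerivAt_id 1).mul_const t
      exact HasDerivAt.comp (h₂ := xα) (h := fun l : ℝ => l * t) 1 (by simpa using hd) h2
    have hG : HasDerivAt (fun l : ℝ => l ^ α) (α * 1 ^ (α - 1)) 1 :=
      Real.hasDerivAt_rpow_const (Or.inl one_ne_zero)
    have := aux_deriv_le _ _ _ _ 1 (M * (C * t ^ α)) hF hG ?_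
    · rw [one_mul, Real.one_rpow, mul_one, abs_mul, abs_of_pos ht, abs_of_pos hα0] at this
      rw [Real.rpow_sub ht, Real.rpow_one, ← mul_div_assoc, le_div_iff₀ ht]
      refine this.trans ?_
      have h3 : 0 ≤ M * C * t ^ α := by positivity
      nlinarith
    · filter_upwards [Ioi_mem_nhds (show (0:ℝ) < 1 from one_pos)] with l hl
      have := bs l hl t ht
      simp only [one_mul, Real.one_rpow]
      refine this.trans (le_of_eq ?_)
      ring
  -- conclusion
  have hLc : ∀ s : ℝ, 0 < s →
      IntegrableOn (fun t => Real.exp (-s * t) * caputoL 0 α xα t) (Ioi 0) ∧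
      ∫ t in Ioi (0:ℝ), Real.exp (-s * t) * caputoL 0 α xα t
      = ∫ t in Ioi (0:ℝ), Real.exp (-s * t) * ∫ τ in Ioi (0:ℝ), p t τ * deriv x τ := by
    intro s hs
    obtain ⟨d1, d2⟩ := aux_lap_deriv α s (M * C) (x 0) hα0 hs xα hxαC (hLh s hs).1
      (fun t ht => (b0 t ht).trans (le_of_eq (by ring))) b1
    obtain ⟨c1, c2⟩ := aux_lap_caputo α s hα1 hs xα d1
    refine ⟨c1, ?_⟩
    rw [c2, d2, (hLg s hs).2, (hLh s hs).2, aux_ibp x hx M (s ^ α) (hpow s hs) hM]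
    congr 2
    rw [← mul_assoc, Real.rpow_sub hs, Real.rpow_one]
    field_simp
  have hae := aux_laplace_eq (fun t => caputoL 0 α xα t) _ (fun s hs => (hLc s hs).1)
    (fun s hs => (hLg s hs).1) (fun s hs => (hLc s hs).2)
  exact fun t ht => Measure.eqOn_open_of_ae_eq hae isOpen_Ioi hcont1 hcont2 ht
end

section
/- Let 0 < α < 1, a < b, and let f, g : [a,b] → ℝ be continuously differentiable. Then ∫_a^b (ᶜD^α_{a+} f)(t) g(t) dt = ∫_a^b f(t) (ᶜD^α_{b−} g)(t) dt + g(b) · (1/Γ(1−α)) ∫_a^b (b−τ)^{−α} f(τ) dτ − f(a) · (1/Γ(1−α)) ∫_a^b (τ−a)^{−α} g(τ) dτ, all integrals being convergent. -/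
open MeasureTheory Set intervalIntegral

/-- The right Caputo derivative of order `α` with base point `b`. -/
noncomputable def caputoR (b α : ℝ) (f : ℝ → ℝ) (t : ℝ) : ℝ :=
  -(Real.Gamma (1 - α))⁻¹ * ∫ τ in t..b, (τ - t) ^ (-α) * deriv f τ

theorem fib_aux (α a b : ℝ) (hα1 : α < 1) (hab : a < b) (u v : ℝ → ℝ)
    (hu : Continuous u) (hv : Continuous v) :
    IntervalIntegrable (fun t => (∫ τ in a..t, (t - τ) ^ (-α) * u τ) * v t) volume a b ∧
    IntervalIntegrable (fun s => s ^ (-α) * ∫ t in (a + s)..b, u (t - s) * v t) volume 0 (b - a) ∧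
    ∫ t in a..b, (∫ τ in a..t, (t - τ) ^ (-α) * u τ) * v t
      = ∫ s in (0:ℝ)..(b - a), s ^ (-α) * ∫ t in (a + s)..b, u (t - s) * v t := by
  have hba : (0:ℝ) ≤ b - a := by linarith
  set μ : Measure ℝ := volume.restrict (Ioc 0 (b - a)) with hμ
  set ν : Measure ℝ := volume.restrict (Ioc a b) with hν
  let S : Set (ℝ × ℝ) := {p | a + p.1 ≤ p.2}
  have hS : MeasurableSet S := measurableSet_le (by fun_prop) (by fun_prop)
  let G : ℝ × ℝ → ℝ := S.indicator (fun p => u (p.2 - p.1) * v p.2)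
  obtain ⟨C, hC⟩ := (isCompact_Icc (a := a) (b := b)).exists_bound_of_continuousOn hu.continuousOn
  obtain ⟨D, hD⟩ := (isCompact_Icc (a := a) (b := b)).exists_bound_of_continuousOn hv.continuousOn
  have hC0 : 0 ≤ C := (norm_nonneg _).trans (hC a ⟨le_rfl, hab.le⟩)
  have hD0 : 0 ≤ D := (norm_nonneg _).trans (hD a ⟨le_rfl, hab.le⟩)
  have hk : Integrable (fun s : ℝ => s ^ (-α)) μ := by
    have := (intervalIntegrable_rpow' (a := 0) (b := b - a) (r := -α) (by linarith))
    exact (intervalIntegrable_iff_integrableOn_Ioc_of_le hba).1 this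
  have hkp : Integrable (fun p : ℝ × ℝ => p.1 ^ (-α)) (μ.prod ν) := by
    have := hk.mul_prod (integrable_const (1:ℝ) (μ := ν))
    simpa using this
  have hGm : AEStronglyMeasurable G (μ.prod ν) := by
    apply AEStronglyMeasurable.indicator _ hS
    exact Continuous.aestronglyMeasurable (by fun_prop)
  have hrect : ∀ᵐ p ∂(μ.prod ν), p ∈ Ioc 0 (b - a) ×ˢ Ioc a b := by
    rw [hμ, hν, Measure.prod_restrict]
    exact ae_restrict_mem (measurableSet_Ioc.prod measurableSet_Ioc)
  have hGb : ∀ᵐ p ∂(μ.prod ν), ‖G p‖ ≤ C * D := by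
    filter_upwards [hrect] with p hp
    obtain ⟨⟨h1, h2⟩, h3, h4⟩ := hp
    by_cases h : p ∈ S
    · have h' : a + p.1 ≤ p.2 := h
      simp only [G, indicator_of_mem h, norm_mul]
      exact mul_le_mul (hC _ ⟨by linarith, by linarith⟩) (hD _ ⟨by linarith, h4⟩)
        (norm_nonneg _) hC0
    · simp only [G, indicator_of_notMem h, norm_zero]
      positivity
  have hH : Integrable (fun p : ℝ × ℝ => p.1 ^ (-α) * G p) (μ.prod ν) :=
    hkp.mul_bdd hGm hGb
  have e1 : ∀ t ∈ Ioc a b, ∫ s, s ^ (-α) * G (s, t) ∂μ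
      = (∫ τ in a..t, (t - τ) ^ (-α) * u τ) * v t := by
    intro t ht
    have : ∀ s, s ^ (-α) * G (s, t)
        = (Iic (t - a)).indicator (fun s => s ^ (-α) * u (t - s) * v t) s := by
      intro s
      by_cases h : a + s ≤ t
      · have h1 : (s, t) ∈ S := h
        have h2 : s ∈ Iic (t - a) := by simp only [mem_Iic]; linarith
        simp only [G, indicator_of_mem h1, indicator_of_mem h2]; ring
      · have h1 : (s, t) ∉ S := h
        have h2 : s ∉ Iic (t - a) := by simp only [mem_Iic]; intro; apply h; linarith
        simp only [G, indicator_of_notMem h1, indicator_of_notMem h2]; ring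
    simp only [this]
    rw [hμ, setIntegral_indicator measurableSet_Iic, Ioc_inter_Iic,
      min_eq_right (by linarith [ht.2]), ← intervalIntegral.integral_of_le (by linarith [ht.1]),
      intervalIntegral.integral_mul_const]
    congr 1
    have := intervalIntegral.integral_comp_sub_left (a := 0) (b := t - a)
      (fun τ => (t - τ) ^ (-α) * u τ) t
    simpa using this
  have e2 : ∀ s ∈ Ioc 0 (b - a), ∫ t, s ^ (-α) * G (s, t) ∂ν
      = s ^ (-α) * ∫ t in (a + s)..b, u (t - s) * v t := by
    intro s hs
    have : ∀ t, G (s, t) = (Ici (a + s)).indicator (fun t => u (t - s) * v t) t := by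
      intro t
      rfl
    simp only [this]
    rw [MeasureTheory.integral_const_mul, hν, setIntegral_indicator measurableSet_Ici]
    have h3 : Ioc a b ∩ Ici (a + s) = Icc (a + s) b := by
      ext x
      simp only [mem_inter_iff, mem_Ioc, mem_Ici, mem_Icc]
      constructor
      · rintro ⟨⟨_, h⟩, h'⟩; exact ⟨h', h⟩
      · rintro ⟨h, h'⟩; exact ⟨⟨by linarith [hs.1], h'⟩, h⟩
    rw [h3, integral_Icc_eq_integral_Ioc, intervalIntegral.integral_of_le (by linarith [hs.2])]
  refine ⟨?_, ?_, ?_⟩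
  · rw [intervalIntegrable_iff_integrableOn_Ioc_of_le hab.le]
    refine Integrable.congr hH.integral_prod_right ?_
    filter_upwards [ae_restrict_mem measurableSet_Ioc] with t ht using e1 t ht
  · rw [intervalIntegrable_iff_integrableOn_Ioc_of_le hba]
    refine Integrable.congr hH.integral_prod_left ?_
    filter_upwards [ae_restrict_mem measurableSet_Ioc] with t ht using e2 t ht
  · rw [intervalIntegral.integral_of_le hab.le, intervalIntegral.integral_of_le hba,
      ← setIntegral_congr_fun measurableSet_Ioc e1, ← setIntegral_congr_fun measurableSet_Ioc e2]
    exact (integral_integral_swap (f := fun s t => s ^ (-α) * G (s, t)) hH).symm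

theorem fib_auxR (α a b : ℝ) (hα1 : α < 1) (hab : a < b) (u v : ℝ → ℝ)
    (hu : Continuous u) (hv : Continuous v) :
    IntervalIntegrable (fun t => u t * (∫ τ in t..b, (τ - t) ^ (-α) * v τ)) volume a b ∧
    ∫ t in a..b, u t * (∫ τ in t..b, (τ - t) ^ (-α) * v τ)
      = ∫ s in (0:ℝ)..(b - a), s ^ (-α) * ∫ t in (a + s)..b, u (t - s) * v t := by
  obtain ⟨h1, -, h3⟩ := fib_aux α (-b) (-a) hα1 (by linarith) (fun x => v (-x)) (fun x => u (-x))
    (by fun_prop) (by fun_prop)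
  have key : ∀ t, (∫ τ in (-b)..(-t), (-t - τ) ^ (-α) * v (-τ))
      = ∫ τ in t..b, (τ - t) ^ (-α) * v τ := by
    intro t
    have := intervalIntegral.integral_comp_neg (a := -b) (b := -t)
      (fun τ => (τ - t) ^ (-α) * v τ)
    simp only [neg_neg] at this
    rw [← this]
    congr 1; ext τ; congr 2; ring
  constructor
  · have := (IntervalIntegrable.iff_comp_neg enorm_ne_top).1 h1
    simp only [neg_neg, key] at this
    refine this.symm.congr ?_
    intro t _
    simp only [mul_comm]
  · have h4 := intervalIntegral.integral_comp_neg (a := a) (b := b)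
      (fun t => (∫ τ in (-b)..t, (t - τ) ^ (-α) * v (-τ)) * u (-t))
    rw [h3] at h4
    simp only [neg_neg, key] at h4
    rw [show -a - -b = b - a by ring] at h4
    calc _ = ∫ t in a..b, (∫ τ in t..b, (τ - t) ^ (-α) * v τ) * u t := by
          simp only [mul_comm]
      _ = _ := h4
      _ = _ := by
          congr 1; ext s; congr 1
          have := intervalIntegral.integral_comp_sub_left (a := a + s) (b := b)
            (fun t => v (-(t - s)) * u (-t)) s
          rw [show s - b = -b + s by ring, show s - (a + s) = -a by ring] at this
          rw [← this]
          congr 1; ext t; rw [mul_comm]; congr 2 <;> ring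

/-- the fractional integration by parts formula
`∫_a^b (ᶜD^α_{a+} f) g = ∫_a^b f (ᶜD^α_{b−} g) + g(b)·(1/Γ(1−α))∫_a^b (b−τ)^{−α} f(τ) dτ
− f(a)·(1/Γ(1−α))∫_a^b (τ−a)^{−α} g(τ) dτ`, with all integrals convergent. -/
theorem fractional_integration_by_parts (α a b : ℝ) (hα0 : 0 < α) (hα1 : α < 1)
    (hab : a < b) (f g : ℝ → ℝ) (hf : ContDiff ℝ 1 f) (hg : ContDiff ℝ 1 g) :
    IntervalIntegrable (fun t => caputoL a α f t * g t) volume a b ∧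
    IntervalIntegrable (fun t => f t * caputoR b α g t) volume a b ∧
    IntervalIntegrable (fun τ => (b - τ) ^ (-α) * f τ) volume a b ∧
    IntervalIntegrable (fun τ => (τ - a) ^ (-α) * g τ) volume a b ∧
    ∫ t in a..b, caputoL a α f t * g t
      = (∫ t in a..b, f t * caputoR b α g t)
        + g b * ((Real.Gamma (1 - α))⁻¹ * ∫ τ in a..b, (b - τ) ^ (-α) * f τ)
        - f a * ((Real.Gamma (1 - α))⁻¹ * ∫ τ in a..b, (τ - a) ^ (-α) * g τ) := by
  have hf' : Continuous (deriv f) := hf.continuous_deriv le_rfl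
  have hg' : Continuous (deriv g) := hg.continuous_deriv le_rfl
  have hba : (0:ℝ) ≤ b - a := by linarith
  obtain ⟨i1, i2, i3⟩ := fib_aux α a b hα1 hab (deriv f) g hf' hg.continuous
  obtain ⟨j1, j3⟩ := fib_auxR α a b hα1 hab f (deriv g) hf.continuous hg'
  obtain ⟨-, j2, -⟩ := fib_aux α a b hα1 hab f (deriv g) hf.continuous hg'
  have hk : IntervalIntegrable (fun s : ℝ => s ^ (-α)) volume 0 (b - a) :=
    intervalIntegrable_rpow' (by linarith)
  have p1 : IntervalIntegrable (fun s : ℝ => s ^ (-α) * f (b - s)) volume 0 (b - a) :=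
    hk.mul_continuousOn (hf.continuous.comp (by fun_prop)).continuousOn
  have p2 : IntervalIntegrable (fun s : ℝ => s ^ (-α) * g (a + s)) volume 0 (b - a) :=
    hk.mul_continuousOn (hg.continuous.comp (by fun_prop)).continuousOn
  have q1 : ∫ s in (0:ℝ)..(b - a), s ^ (-α) * f (b - s) = ∫ τ in a..b, (b - τ) ^ (-α) * f τ := by
    have := intervalIntegral.integral_comp_sub_left (a := 0) (b := b - a)
      (fun τ => (b - τ) ^ (-α) * f τ) b
    simpa using this
  have q2 : ∫ s in (0:ℝ)..(b - a), s ^ (-α) * g (a + s) = ∫ τ in a..b, (τ - a) ^ (-α) * g τ := by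
    have := intervalIntegral.integral_comp_add_left (a := 0) (b := b - a)
      (fun τ => (τ - a) ^ (-α) * g τ) a
    simpa using this
  have parts : ∀ s, ∫ t in (a + s)..b, deriv f (t - s) * g t
      = f (b - s) * g b - f a * g (a + s) - ∫ t in (a + s)..b, f (t - s) * deriv g t := by
    intro s
    have hfd : ∀ x, HasDerivAt (fun t => f (t - s)) (deriv f (x - s)) x := fun x =>
      ((hf.differentiable one_ne_zero _).hasDerivAt).comp_sub_const x s
    have hgd : ∀ x, HasDerivAt g (deriv g x) x := fun x =>
      (hg.differentiable one_ne_zero _).hasDerivAt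
    have := intervalIntegral.integral_mul_deriv_eq_deriv_mul (a := a + s) (b := b)
      (fun x _ => hfd x) (fun x _ => hgd x)
      (Continuous.intervalIntegrable (by fun_prop) _ _) (hg'.intervalIntegrable _ _)
    rw [this]
    simp only [add_sub_cancel_right]
    ring
  refine ⟨?_, ?_, ?_, ?_, ?_⟩
  · simp only [caputoL, mul_assoc]
    exact i1.const_mul _
  · simp only [caputoR, mul_left_comm (f _)]
    exact j1.const_mul _
  · have := (p1.comp_sub_left b).symm
    simpa using this
  · have := p2.comp_sub_right a
    simpa using this
  · simp only [caputoL, caputoR, mul_assoc, mul_left_comm (f _),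
      intervalIntegral.integral_const_mul]
    rw [i3, j3, ← q1, ← q2]
    have : ∫ s in (0:ℝ)..(b - a), s ^ (-α) * ∫ t in (a + s)..b, deriv f (t - s) * g t
        = g b * (∫ s in (0:ℝ)..(b - a), s ^ (-α) * f (b - s))
          - f a * (∫ s in (0:ℝ)..(b - a), s ^ (-α) * g (a + s))
          - ∫ s in (0:ℝ)..(b - a), s ^ (-α) * ∫ t in (a + s)..b, f (t - s) * deriv g t := by
      rw [← intervalIntegral.integral_const_mul, ← intervalIntegral.integral_const_mul,
        ← intervalIntegral.integral_sub (p1.const_mul _) (p2.const_mul _),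
        ← intervalIntegral.integral_sub ((p1.const_mul _).sub (p2.const_mul _)) j2]
      congr 1; ext s; rw [parts]; ring
    rw [this]
    ring
end

section
/- Let 0 < α < 1 and a < b. If f : [a,b] → ℝ is continuous and ∫_a^b f(t) h(t) dt = 0 for every h ∈ V_α, then f(t) = 0 for all t ∈ [a,b]. -/
open MeasureTheory Set intervalIntegral

/-- The space of variations `V_α`: C¹ functions with `h(b) = 0` and
`∫_a^b (τ−a)^{−α} h(τ) dτ = 0`. -/
def memV (α a b : ℝ) (h : ℝ → ℝ) : Prop :=
  ContDiff ℝ 1 h ∧ h b = 0 ∧ (∫ τ in a..b, (τ - a) ^ (-α) * h τ) = 0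


/-- On the open interval, a continuous function orthogonal to all test functions vanishes. -/
lemma aux_zero (a b : ℝ) (u : ℝ → ℝ) (hu : ContinuousOn u (Ioo a b))
    (h : ∀ g : ℝ → ℝ, ContDiff ℝ ((⊤ : ℕ∞) : WithTop ℕ∞) g → HasCompactSupport g →
      tsupport g ⊆ Ioo a b → ∫ t in a..b, u t * g t = 0) (hab : a < b) :
    ∀ t ∈ Ioo a b, u t = 0 := by
  have h1 : ∀ᵐ x ∂(volume : Measure ℝ), x ∈ Ioo a b → u x = 0 := by
    refine isOpen_Ioo.ae_eq_zero_of_integral_contDiff_smul_eq_zero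
      (hu.locallyIntegrableOn measurableSet_Ioo) ?_
    intro g hg hgc hgs
    have h2 := h g hg hgc hgs
    rw [intervalIntegral.integral_of_le hab.le] at h2
    rw [← h2, setIntegral_eq_integral_of_forall_compl_eq_zero]
    · simp only [smul_eq_mul, mul_comm]
    · intro x hx
      have : g x = 0 := by
        by_contra hne
        exact hx (Ioo_subset_Ioc_self (hgs (subset_tsupport g hne)))
      simp [this]
  have h2 : u =ᵐ[volume.restrict (Ioo a b)] (fun _ => (0 : ℝ)) :=
    (ae_restrict_iff' measurableSet_Ioo).2 h1
  exact Measure.eqOn_open_of_ae_eq h2 isOpen_Ioo hu continuousOn_const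

lemma aux_int (a b : ℝ) (u g : ℝ → ℝ) (hu : ContinuousOn u (Ioo a b)) (hg : Continuous g)
    (hgc : HasCompactSupport g) (hgs : tsupport g ⊆ Ioo a b) :
    IntervalIntegrable (fun t => u t * g t) volume a b := by
  have h1 : IntegrableOn (fun t => u t * g t) (tsupport g) volume :=
    ((hu.mono hgs).mul hg.continuousOn).integrableOn_compact hgc
  have h2 : Integrable (fun t => u t * g t) volume := by
    refine (integrableOn_iff_integrable_of_support_subset ?_).1 h1
    intro x hx
    apply subset_tsupport g
    intro h0
    exact hx (by simp [h0])
  exact h2.intervalIntegrable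

/-- fundamental lemma of the fractional calculus of variations:
a continuous function orthogonal to every `h ∈ V_α` vanishes identically on `[a,b]`. -/
theorem fundamental_lemma_Valpha (α a b : ℝ) (hα0 : 0 < α) (hα1 : α < 1) (hab : a < b)
    (f : ℝ → ℝ) (hf : ContinuousOn f (Icc a b))
    (horth : ∀ h : ℝ → ℝ, memV α a b h → ∫ t in a..b, f t * h t = 0) :
    ∀ t ∈ Icc a b, f t = 0 := by
  set w : ℝ → ℝ := fun t => (t - a) ^ (-α) with hw
  have hwc : ContinuousOn w (Ioo a b) := by
    apply ContinuousOn.rpow_const (by fun_prop)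
    intro x hx
    exact Or.inl (sub_pos.2 hx.1).ne'
  have hfo : ContinuousOn f (Ioo a b) := hf.mono Ioo_subset_Icc_self
  have hgb : ∀ g : ℝ → ℝ, tsupport g ⊆ Ioo a b → g b = 0 := by
    intro g hgs
    by_contra hne
    exact absurd (hgs (subset_tsupport g hne)).2 (lt_irrefl b)
  -- a test function not orthogonal to the weight
  obtain ⟨p, hp, hpc, hps, hp0⟩ : ∃ p : ℝ → ℝ, ContDiff ℝ ((⊤ : ℕ∞) : WithTop ℕ∞) p ∧
      HasCompactSupport p ∧ tsupport p ⊆ Ioo a b ∧ ∫ t in a..b, w t * p t ≠ 0 := by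
    by_contra hcon
    push Not at hcon
    have := aux_zero a b w hwc hcon hab ((a + b) / 2) ⟨by linarith, by linarith⟩
    have h3 : 0 < w ((a + b) / 2) := Real.rpow_pos_of_pos (by linarith) _
    exact h3.ne' this
  set P := ∫ t in a..b, w t * p t with hP
  set c := (∫ t in a..b, f t * p t) / P with hc
  have key : ∀ t ∈ Ioo a b, f t - c * w t = 0 := by
    refine aux_zero a b (fun t => f t - c * w t) (hfo.sub (hwc.const_smul c)) ?_ hab
    intro g hg hgc hgs
    have iwg := aux_int a b w g hwc hg.continuous hgc hgs
    have iwp := aux_int a b w p hwc hp.continuous hpc hps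
    have ifg := aux_int a b f g hfo hg.continuous hgc hgs
    have ifp := aux_int a b f p hfo hp.continuous hpc hps
    set d := (∫ t in a..b, w t * g t) / P with hd
    have hV : memV α a b (fun t => g t - d * p t) := by
      refine ⟨?_, ?_, ?_⟩
      · exact (hg.of_le (by exact_mod_cast le_top)).sub
          (contDiff_const.mul (hp.of_le (by exact_mod_cast le_top)))
      · simp [hgb g hgs, hgb p hps]
      · have e : (fun τ => (τ - a) ^ (-α) * (g τ - d * p τ))
            = fun τ => w τ * g τ - d * (w τ * p τ) := by
          funext τ; simp only [hw]; ring
        rw [e, intervalIntegral.integral_sub iwg (iwp.const_mul d),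
          intervalIntegral.integral_const_mul, ← hP, hd]
        field_simp
        ring
    have h1 := horth _ hV
    have e : (fun t => f t * (g t - d * p t)) = fun t => f t * g t - d * (f t * p t) := by
      funext t; ring
    rw [e, intervalIntegral.integral_sub ifg (ifp.const_mul d),
      intervalIntegral.integral_const_mul] at h1
    have e2 : (fun t => (f t - c * w t) * g t) = fun t => f t * g t - c * (w t * g t) := by
      funext t; ring
    rw [e2, intervalIntegral.integral_sub ifg (iwg.const_mul c),
      intervalIntegral.integral_const_mul, ← h1, hc, hd]
    ring
  have hcl : Icc a b ⊆ closure (Ioo a b) := by rw [closure_Ioo hab.ne]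
  have h1 : EqOn (fun t => (t - a) ^ α * f t) (fun _ => c) (Ioo a b) := by
    intro t ht
    have h2 := key t ht
    have hpos : 0 < t - a := sub_pos.2 ht.1
    have h3 : f t = c * (t - a) ^ (-α) := by simpa [hw] using sub_eq_zero.1 h2
    have h4 : (t - a) ^ α * (t - a) ^ (-α) = 1 := by
      rw [← Real.rpow_add hpos]; simp
    simp only
    rw [h3]
    linear_combination c * h4
  have h2 := h1.of_subset_closure
    (((by fun_prop : ContinuousOn (fun t : ℝ => t - a) (Icc a b)).rpow_const
      (fun _ _ => Or.inr hα0.le)).mul hf) continuousOn_const Ioo_subset_Icc_self hcl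
  have hc0 : c = 0 := by
    have := h2 (left_mem_Icc.2 hab.le)
    simpa [Real.zero_rpow hα0.ne', eq_comm] using this
  have h3 : EqOn f (fun _ => (0 : ℝ)) (Ioo a b) := by
    intro t ht
    simpa [hc0] using key t ht
  exact h3.of_subset_closure hf continuousOn_const Ioo_subset_Icc_self hcl
end

section
/- Let 0 < α < 1 and a < b. Define K_α f = ᶜD^α_{a+} f + ᶜD^α_{b−} f for C¹ functions f on [a,b]. Then for all f, g ∈ V_α, ⟨K_α f, g⟩ = ⟨f, K_α g⟩, where ⟨u,v⟩ = ∫_a^b u(t) v(t) dt. -/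
open MeasureTheory Set intervalIntegral

lemma core_fubini (α L : ℝ) (hα1 : α < 1) (hL : 0 ≤ L) (G : ℝ → ℝ → ℝ)
    (hG : Continuous fun p : ℝ × ℝ => G p.1 p.2) :
    (∫ u in (0:ℝ)..L, ∫ s in (0:ℝ)..u, s ^ (-α) * G u s)
      = (∫ s in (0:ℝ)..L, s ^ (-α) * ∫ u in s..L, G u s) ∧
    IntervalIntegrable (fun u => ∫ s in (0:ℝ)..u, s ^ (-α) * G u s) volume 0 L ∧
    IntervalIntegrable (fun s => s ^ (-α) * ∫ u in s..L, G u s) volume 0 L := by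
  set μ : Measure ℝ := volume.restrict (Ioc 0 L) with hμ
  set Φ : ℝ → ℝ → ℝ := fun u s => {p : ℝ × ℝ | p.2 ≤ p.1}.indicator
    (fun p => p.2 ^ (-α) * G p.1 p.2) (u, s) with hΦ
  have hmeas : MeasurableSet {p : ℝ × ℝ | p.2 ≤ p.1} :=
    measurableSet_le measurable_snd measurable_fst
  have h1 : Integrable (fun s : ℝ => s ^ (-α)) μ := by
    have := intervalIntegrable_rpow' (a := 0) (b := L) (r := -α) (by linarith)
    rwa [intervalIntegrable_iff_integrableOn_Ioc_of_le hL] at this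
  have hint : Integrable (Function.uncurry Φ) (μ.prod μ) := by
    have h2 : Integrable (fun p : ℝ × ℝ => p.2 ^ (-α)) (μ.prod μ) := h1.comp_snd μ
    obtain ⟨C, hC⟩ := ((isCompact_Icc (a := (0:ℝ)) (b := L)).prod
      (isCompact_Icc (a := (0:ℝ)) (b := L))).exists_bound_of_continuousOn hG.continuousOn
    have h3 : Integrable (fun p : ℝ × ℝ => p.2 ^ (-α) * G p.1 p.2) (μ.prod μ) := by
      refine h2.mul_bdd (c := C) hG.aestronglyMeasurable ?_
      rw [hμ, Measure.prod_restrict]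
      refine (ae_restrict_iff' (measurableSet_Ioc.prod measurableSet_Ioc)).2 (ae_of_all _ ?_)
      intro p hp
      exact hC p ⟨Ioc_subset_Icc_self hp.1, Ioc_subset_Icc_self hp.2⟩
    exact h3.indicator hmeas
  have hA : ∀ u ∈ Ioc 0 L, (∫ s, Φ u s ∂μ) = ∫ s in (0:ℝ)..u, s ^ (-α) * G u s := by
    intro u hu
    rw [integral_of_le hu.1.le]
    have : Φ u = (Iic u).indicator (fun s => s ^ (-α) * G u s) := by
      ext s; simp [hΦ, indicator]
    rw [this, setIntegral_indicator measurableSet_Iic]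
    congr 2
    ext s; simp only [mem_inter_iff, mem_Ioc, mem_Iic]
    exact ⟨fun h => ⟨h.1.1, h.2⟩, fun h => ⟨⟨h.1, h.2.trans hu.2⟩, h.2⟩⟩
  have hB : ∀ s ∈ Ioc 0 L, (∫ u, Φ u s ∂μ) = s ^ (-α) * ∫ u in s..L, G u s := by
    intro s hs
    have hI : (∫ u in s..L, G u s) = ∫ u in Icc s L, G u s := by
      rw [integral_of_le hs.2, integral_Icc_eq_integral_Ioc]
    rw [hI, ← MeasureTheory.integral_const_mul]
    have : (fun u => Φ u s) = (Ici s).indicator (fun u => s ^ (-α) * G u s) := by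
      ext u; simp [hΦ, indicator]
    rw [this, setIntegral_indicator measurableSet_Ici]
    congr 2
    ext u; simp only [mem_inter_iff, mem_Ioc, mem_Ici, mem_Icc]
    exact ⟨fun h => ⟨h.2, h.1.2⟩, fun h => ⟨⟨hs.1.trans_le h.1, h.2⟩, h.1⟩⟩
  refine ⟨?_, ?_, ?_⟩
  · rw [integral_of_le hL, integral_of_le hL, ← setIntegral_congr_fun measurableSet_Ioc hA,
      ← setIntegral_congr_fun measurableSet_Ioc hB]
    exact integral_integral_swap hint
  · rw [intervalIntegrable_iff_integrableOn_Ioc_of_le hL]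
    exact (integrableOn_congr_fun hA measurableSet_Ioc).1 hint.integral_prod_left
  · rw [intervalIntegrable_iff_integrableOn_Ioc_of_le hL]
    exact (integrableOn_congr_fun hB measurableSet_Ioc).1 hint.integral_prod_right

lemma key_parts (α a b : ℝ) (hα1 : α < 1) (hab : a < b)
    (f g : ℝ → ℝ) (hf : ContDiff ℝ 1 f) (hg : memV α a b g) :
    (∫ t in a..b, caputoL a α f t * g t) = (∫ t in a..b, f t * caputoR b α g t) ∧
    IntervalIntegrable (fun t => caputoL a α f t * g t) volume a b ∧
    IntervalIntegrable (fun t => f t * caputoR b α g t) volume a b := by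
  obtain ⟨hg1, hgb, hgi⟩ := hg
  have cf := hf.continuous
  have cg := hg1.continuous
  have cf' : Continuous (deriv f) := hf.continuous_deriv (le_refl _)
  have cg' : Continuous (deriv g) := hg1.continuous_deriv (le_refl _)
  have hL : 0 ≤ b - a := by linarith
  set c := (Real.Gamma (1 - α))⁻¹ with hc
  obtain ⟨e1, i1, j1⟩ := core_fubini α (b - a) hα1 hL
    (fun u s => deriv f (a + u - s) * g (a + u)) (by fun_prop)
  obtain ⟨e2, i2, j2⟩ := core_fubini α (b - a) hα1 hL
    (fun u s => f (b - u) * deriv g (b - u + s)) (by fun_prop)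
  have hLf : ∀ t, caputoL a α f t * g t
      = c * ∫ s in (0:ℝ)..(t - a), s ^ (-α) * (deriv f (a + (t - a) - s) * g (a + (t - a))) := by
    intro t
    have : (∫ τ in a..t, (t - τ) ^ (-α) * deriv f τ)
        = ∫ s in (0:ℝ)..(t - a), s ^ (-α) * deriv f (t - s) := by
      have := integral_comp_sub_left (a := a) (b := t) (fun s => s ^ (-α) * deriv f (t - s)) t
      simpa using this
    rw [caputoL, this, ← hc, mul_assoc, ← intervalIntegral.integral_mul_const]
    simp only [add_sub_cancel, mul_assoc]
  have hRg : ∀ t, f t * caputoR b α g t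
      = -c * ∫ s in (0:ℝ)..(b - t),
          s ^ (-α) * (f (b - (b - t)) * deriv g (b - (b - t) + s)) := by
    intro t
    have : (∫ τ in t..b, (τ - t) ^ (-α) * deriv g τ)
        = ∫ s in (0:ℝ)..(b - t), s ^ (-α) * deriv g (t + s) := by
      have := integral_comp_sub_right (a := t) (b := b) (fun s => s ^ (-α) * deriv g (t + s)) t
      simpa using this
    rw [caputoR, this, ← hc, mul_left_comm, ← intervalIntegral.integral_const_mul]
    simp only [sub_sub_cancel, mul_left_comm]
  have E1 : (∫ t in a..b, caputoL a α f t * g t)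
      = c * ∫ u in (0:ℝ)..(b - a), ∫ s in (0:ℝ)..u,
        s ^ (-α) * (deriv f (a + u - s) * g (a + u)) := by
    simp_rw [hLf]
    rw [intervalIntegral.integral_const_mul]
    congr 1
    have := integral_comp_sub_right (a := a) (b := b) (fun u => ∫ s in (0:ℝ)..u,
        s ^ (-α) * (deriv f (a + u - s) * g (a + u))) a
    rw [sub_self] at this
    exact this
  have E2 : (∫ t in a..b, f t * caputoR b α g t)
      = -c * ∫ u in (0:ℝ)..(b - a), ∫ s in (0:ℝ)..u,
        s ^ (-α) * (f (b - u) * deriv g (b - u + s)) := by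
    simp_rw [hRg]
    rw [intervalIntegral.integral_const_mul]
    congr 1
    have := integral_comp_sub_left (a := a) (b := b) (fun u => ∫ s in (0:ℝ)..u,
        s ^ (-α) * (f (b - u) * deriv g (b - u + s))) b
    rw [sub_self] at this
    exact this
  refine ⟨?_, ?_, ?_⟩
  · rw [E1, E2, e1, e2]
    have inner : ∀ s, (∫ u in s..(b - a), deriv f (a + u - s) * g (a + u))
        = -(f a * g (a + s)) - ∫ u in s..(b - a), f (b - u) * deriv g (b - u + s) := by
      intro s
      have hp := integral_deriv_mul_eq_sub (a := s) (b := b - a)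
        (u := fun u => f (a + u - s)) (v := fun u => g (a + u))
        (u' := fun u => deriv f (a + u - s)) (v' := fun u => deriv g (a + u))
        (fun x _ => by
          have := (hf.differentiable (by norm_num) (a + x - s)).hasDerivAt.comp x
            (((hasDerivAt_id x).const_add a).sub_const s)
          rw [mul_one] at this
          exact this)
        (fun x _ => by
          have := (hg1.differentiable (by norm_num) (a + x)).hasDerivAt.comp x
            ((hasDerivAt_id x).const_add a)
          rw [mul_one] at this
          exact this)
        (Continuous.intervalIntegrable (by fun_prop) _ _)
        (Continuous.intervalIntegrable (by fun_prop) _ _)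
      rw [intervalIntegral.integral_add (Continuous.intervalIntegrable (by fun_prop) _ _)
        (Continuous.intervalIntegrable (by fun_prop) _ _)] at hp
      have hr := integral_comp_sub_left (a := s) (b := b - a)
        (fun v => f (a + v - s) * deriv g (a + v)) (b - a + s)
      have e : ∀ x, a + (b - a + s - x) - s = b - x := fun x => by ring
      have e' : ∀ x, a + (b - a + s - x) = b - x + s := fun x => by ring
      simp only [e, e', add_sub_cancel_right, add_sub_cancel_left] at hr
      rw [hr]
      have e3 : a + (b - a) = b := by ring
      have e4 : a + s - s = a := by ring
      simp only [e3, e4, hgb, mul_zero] at hp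
      linarith
    have hz : (∫ s in (0:ℝ)..(b - a), s ^ (-α) * g (a + s)) = 0 := by
      have := integral_comp_sub_right (a := a) (b := b) (fun s => s ^ (-α) * g (a + s)) a
      simp only [add_sub_cancel, sub_self] at this
      rw [← this, hgi]
    have hzi : IntervalIntegrable (fun s : ℝ => s ^ (-α) * g (a + s)) volume 0 (b - a) :=
      (intervalIntegrable_rpow' (by linarith)).mul_continuousOn
        (Continuous.continuousOn (by fun_prop))
    have : ∀ s : ℝ, s ^ (-α) * (∫ u in s..(b - a), deriv f (a + u - s) * g (a + u))
        = (-f a) * (s ^ (-α) * g (a + s))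
          - s ^ (-α) * ∫ u in s..(b - a), f (b - u) * deriv g (b - u + s) := by
      intro s; rw [inner]; ring
    simp_rw [this]
    rw [intervalIntegral.integral_sub (hzi.const_mul _) j2,
      intervalIntegral.integral_const_mul, hz]
    ring
  · have := (i1.comp_sub_right a).const_mul c
    simp only [zero_add, sub_add_cancel] at this
    exact this.congr (fun t _ => (hLf t).symm)
  · have := ((i2.comp_sub_left b).const_mul (-c)).symm
    rw [sub_zero, sub_sub_cancel] at this
    exact this.congr (fun t _ => (hRg t).symm)

/-- the operator `K_α = ᶜD^α_{a+} + ᶜD^α_{b−}` is symmetric on `V_α`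
with respect to the L² inner product `⟨u,v⟩ = ∫_a^b u v`. -/
theorem Kalpha_symmetric (α a b : ℝ) (hα0 : 0 < α) (hα1 : α < 1) (hab : a < b)
    (f g : ℝ → ℝ) (hf : memV α a b f) (hg : memV α a b g) :
    ∫ t in a..b, (caputoL a α f t + caputoR b α f t) * g t
      = ∫ t in a..b, f t * (caputoL a α g t + caputoR b α g t) := by
  obtain ⟨e1, i1, j1⟩ := key_parts α a b hα1 hab f g hf.1 hg
  obtain ⟨e2, i2, j2⟩ := key_parts α a b hα1 hab g f hg.1 hf
  have h1 : ∀ t, (caputoL a α f t + caputoR b α f t) * g t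
      = caputoL a α f t * g t + g t * caputoR b α f t := fun t => by ring
  have h2 : ∀ t, f t * (caputoL a α g t + caputoR b α g t)
      = caputoL a α g t * f t + f t * caputoR b α g t := fun t => by ring
  simp_rw [h1, h2]
  rw [intervalIntegral.integral_add i1 j2, intervalIntegral.integral_add i2 j1, e1, e2, add_comm]
end

section
/- Let 0 < α < 1, a < b, let L : ℝ × ℝ → ℝ be twice continuously differentiable with v ↦ ∂₂L(x,v) a bijection of ℝ for each x, with C¹ inverse f(x,·), and let H(x,p) = p f(x,p) − L(x, f(x,p)). Let x : [a,b] → ℝ be C¹ such that t ↦ ∂₂L(x(t), (ᶜD^α_{a+} x)(t)) is C¹, and suppose x satisfies the causal fractional Euler–Lagrange equation ∂₁L(x(t), (ᶜD^α_{a+} x)(t)) − ᶜD^α_{a+}[ s ↦ ∂₂L(x(s), (ᶜD^α_{a+} x)(s)) ](t) = 0 for all t ∈ [a,b]. Define p(t) = ∂₂L(x(t), (ᶜD^α_{a+} x)(t)). Then (x,p) satisfies the fractional Hamiltonian equations (ᶜD^α_{a+} x)(t) = ∂₂H(x(t),p(t)) and (ᶜD^α_{a+} p)(t) = −∂₁H(x(t),p(t))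 for all t ∈ [a,b]. -/
open MeasureTheory Set intervalIntegral

/-- if `x` satisfies the causal fractional Euler–Lagrange equation and
`p(t) = ∂₂L(x(t), ᶜD^α_{a+}x(t))`, then `(x,p)` satisfies the fractional Hamiltonian
equations `ᶜD^α_{a+}x = ∂₂H(x,p)`, `ᶜD^α_{a+}p = −∂₁H(x,p)`. -/
theorem causal_EL_to_fractional_hamiltonian (α a b : ℝ) (hα0 : 0 < α) (hα1 : α < 1)
    (hab : a < b) (L L₁ L₂ : ℝ → ℝ → ℝ)
    (hL : ContDiff ℝ 2 fun z : ℝ × ℝ => L z.1 z.2)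
    (hL₁ : ∀ x v : ℝ, HasDerivAt (fun y => L y v) (L₁ x v) x)
    (hL₂ : ∀ x v : ℝ, HasDerivAt (fun w => L x w) (L₂ x v) v)
    (f : ℝ → ℝ → ℝ)
    (hbij : ∀ x : ℝ, Function.Bijective fun v => L₂ x v)
    (hinv : ∀ x p : ℝ, L₂ x (f x p) = p)
    (hfC : ContDiff ℝ 1 fun z : ℝ × ℝ => f z.1 z.2)
    (H : ℝ → ℝ → ℝ)
    (hH : ∀ x p : ℝ, H x p = p * f x p - L x (f x p))
    (x : ℝ → ℝ) (hx : ContDiff ℝ 1 x)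
    (hP : ContDiff ℝ 1 fun t => L₂ (x t) (caputoL a α x t))
    (hEL : ∀ t ∈ Icc a b,
      L₁ (x t) (caputoL a α x t)
        - caputoL a α (fun s => L₂ (x s) (caputoL a α x s)) t = 0) :
    ∀ t ∈ Icc a b,
      caputoL a α x t
        = deriv (fun q => H (x t) q) (L₂ (x t) (caputoL a α x t)) ∧
      caputoL a α (fun s => L₂ (x s) (caputoL a α x s)) t
        = -(deriv (fun y => H y (L₂ (x t) (caputoL a α x t))) (x t)) := by
  intro t ht
  have hEt := hEL t ht
  generalize caputoL a α (fun s => L₂ (x s) (caputoL a α x s)) t = c at hEt ⊢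
  generalize caputoL a α x t = v at hEt ⊢
  generalize x t = y₀ at hEt ⊢
  have hfv : f y₀ (L₂ y₀ v) = v := (hbij y₀).1 (hinv y₀ (L₂ y₀ v))
  generalize hp : L₂ y₀ v = p at hfv ⊢
  have hfd : Differentiable ℝ fun z : ℝ × ℝ => f z.1 z.2 := hfC.differentiable (by norm_num)
  have hLd : Differentiable ℝ fun z : ℝ × ℝ => L z.1 z.2 := hL.differentiable (by norm_num)
  have hf2 : DifferentiableAt ℝ (fun q => f y₀ q) p :=
    (hfd (y₀, p)).comp (f := fun q : ℝ => (y₀, q)) p (by fun_prop)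
  have hf1 : DifferentiableAt ℝ (fun y => f y p) y₀ :=
    (hfd (y₀, p)).comp (f := fun y : ℝ => (y, p)) y₀ (by fun_prop)
  have hF := (hLd (y₀, v)).hasFDerivAt
  set F := fderiv ℝ (fun z : ℝ × ℝ => L z.1 z.2) (y₀, v) with hFdef
  have e1 : F (1, 0) = L₁ y₀ v := by
    have h := hF.comp_hasDerivAt (f := fun y : ℝ => (y, v)) y₀
      ((hasDerivAt_id y₀).prodMk (hasDerivAt_const y₀ v))
    exact h.unique (hL₁ y₀ v)
  have e2 : F (0, 1) = L₂ y₀ v := by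
    have h := hF.comp_hasDerivAt (f := fun w : ℝ => (y₀, w)) v
      ((hasDerivAt_const v y₀).prodMk (hasDerivAt_id v))
    exact h.unique (hL₂ y₀ v)
  have hd2 := hf2.hasDerivAt
  have hd1 := hf1.hasDerivAt
  generalize deriv (fun q => f y₀ q) p = d2 at hd2
  generalize deriv (fun y => f y p) y₀ = d1 at hd1
  constructor
  · have hl : HasDerivAt (fun w => L y₀ w) p (f y₀ p) := by
      have h := hL₂ y₀ v
      rwa [hp, ← hfv] at h
    have h := ((hasDerivAt_id p).mul hd2).sub (hl.comp p hd2)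
    have h' : HasDerivAt (fun q => H y₀ q) v p := by
      have ef : (fun q => H y₀ q) = fun q => q * f y₀ q - L y₀ (f y₀ q) := funext (hH y₀)
      have ev : 1 * f y₀ p + id p * d2 - p * d2 = v := by simp [hfv]
      rw [ev] at h
      rw [ef]
      exact h
    exact h'.deriv.symm
  · have hF' : HasFDerivAt (fun z : ℝ × ℝ => L z.1 z.2) F (y₀, f y₀ p) := by
      rw [hfv]; exact hF
    have hl := hF'.comp_hasDerivAt (f := fun y : ℝ => (y, f y p)) y₀
      ((hasDerivAt_id y₀).prodMk hd1)
    have e3 : F (1, d1) = L₁ y₀ v + d1 * p := by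
      have : ((1 : ℝ), d1) = (1, 0) + d1 • ((0 : ℝ), (1 : ℝ)) := by simp
      rw [this, map_add, map_smul, e1, e2, hp, smul_eq_mul]
    have h := (hd1.const_mul p).sub hl
    have h' : HasDerivAt (fun y => H y p) (-(L₁ y₀ v)) y₀ := by
      have ef : (fun y => H y p) = fun y => p * f y p - L y (f y p) :=
        funext fun y => hH y p
      have ev : p * d1 - F (1, d1) = -(L₁ y₀ v) := by rw [e3]; ring
      rw [ev] at h
      rw [ef]
      exact h
    rw [h'.deriv]
    linarith
end
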